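/- arXiv:2403.13383 — 3 statements merged into one kernel-verified Lean document; each statement's English description precedes it below -/
import Mathlib

section
/- For all real numbers α < β, the proportion of matrices γ in Γ_T with Tr(γ)/T ∈ (α,β) converges as T → ∞ to (2/π) ∫ from max(α,−1) to min(β,1) of √(1−x²) dx (the integral being 0 if max(α,−1) ≥ min(β,1)). That is, lim_{T→∞} |{γ ∈ Γ_T : α < Tr(γ)/T < β}| / |Γ_T| = (2/π) ∫_{max(α,−1)}^{min(β,1)} √(1−x²) dx. -/
noncomputable section

open Matrix Filter Topology

/-- `Γ = SL(2,ℤ)`. -/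
abbrev SL2Z := Matrix.SpecialLinearGroup (Fin 2) ℤ

/-- Frobenius norm of a matrix in `SL(2,ℤ)`. -/
noncomputable def frobNorm (γ : SL2Z) : ℝ :=
  Real.sqrt ((γ 0 0 ^ 2 + γ 0 1 ^ 2 + γ 1 0 ^ 2 + γ 1 1 ^ 2 : ℤ) : ℝ)

/-- Trace of a matrix in `SL(2,ℤ)`. -/
def trZ (γ : SL2Z) : ℤ := γ 0 0 + γ 1 1

open MeasureTheory

theorem card_filter_intCast_mul_eq_le (q : ℕ) [NeZero q] {m : ℤ} (hm : m ≠ 0) (k : ZMod q) :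
    (Finset.univ.filter fun x : ZMod q => (m : ZMod q) * x = k).card ≤ m.natAbs := by
  classical
  rcases (Finset.univ.filter fun x : ZMod q => (m : ZMod q) * x = k).eq_empty_or_nonempty with h | ⟨x₀, hx₀⟩
  · simp [h]
  · have h1 : (Finset.univ.filter fun x : ZMod q => m.natAbs • x = 0).card ≤ m.natAbs :=
      IsAddCyclic.card_nsmul_eq_zero_le (Int.natAbs_pos.mpr hm)
    refine le_trans (Finset.card_le_card_of_injOn (fun x => x - x₀) ?_ ?_) h1
    · intro x hx
      simp only [Finset.coe_filter, Finset.mem_univ, true_and, Set.mem_ofPred_eq, Finset.mem_filter] at hx hx₀ ⊢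
      have : (m : ZMod q) * (x - x₀) = 0 := by rw [mul_sub, hx, hx₀, sub_self]
      rw [nsmul_eq_mul]
      rcases Int.natAbs_eq m with h | h
      · rwa [h, Int.cast_natCast] at this
      · rwa [h, Int.cast_neg, Int.cast_natCast, neg_mul, neg_eq_zero] at this
    · intro x _ y _ h
      simpa using h

theorem exists_divisors_of_mul_mul_eq_zero (q : ℕ) [NeZero q] (x y z : ZMod q) (h : x * y * z = 0) :
    ∃ d₁ ∈ q.divisors, ∃ d₂ ∈ q.divisors, ((q / d₁ : ℕ) : ZMod q) * x = 0 ∧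
      ((q / d₂ : ℕ) : ZMod q) * y = 0 ∧ ((d₁ * d₂ : ℕ) : ZMod q) * z = 0 := by
  obtain ⟨X, rfl⟩ := ZMod.natCast_zmod_surjective x
  obtain ⟨Y, rfl⟩ := ZMod.natCast_zmod_surjective y
  obtain ⟨Z, rfl⟩ := ZMod.natCast_zmod_surjective z
  have hq : 0 < q := NeZero.pos q
  have h' : q ∣ X * (Y * Z) := by
    rw [← ZMod.natCast_eq_zero_iff, ← mul_assoc]; exact_mod_cast h
  have key : ∀ a b w : ℕ, 0 < a → a ∣ b * w → a ∣ Nat.gcd b a * w := by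
    intro a b w _ hab
    rw [← Nat.gcd_mul_right]
    exact Nat.dvd_gcd hab (dvd_mul_right _ _)
  have key2 : ∀ a, ((q / Nat.gcd a q : ℕ) : ZMod q) * a = 0 := by
    intro a
    have : q ∣ q / Nat.gcd a q * a := by
      obtain ⟨c, hc⟩ := Nat.gcd_dvd_left a q
      refine ⟨c, ?_⟩
      calc q / Nat.gcd a q * a = q / Nat.gcd a q * (Nat.gcd a q * c) := by rw [← hc]
        _ = q * c := by rw [← mul_assoc, Nat.div_mul_cancel (Nat.gcd_dvd_right a q)]
    exact_mod_cast (ZMod.natCast_eq_zero_iff _ _).mpr this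
  refine ⟨Nat.gcd X q, ?_, Nat.gcd Y q, ?_, key2 X, key2 Y, ?_⟩
  · exact Nat.mem_divisors.mpr ⟨Nat.gcd_dvd_right _ _, hq.ne'⟩
  · exact Nat.mem_divisors.mpr ⟨Nat.gcd_dvd_right _ _, hq.ne'⟩
  · have h1 := key q X _ hq h'
    have h2 : q ∣ Y * (Nat.gcd X q * Z) := by convert h1 using 1; ring
    have h3 := key q Y _ hq h2
    have : q ∣ Nat.gcd X q * Nat.gcd Y q * Z := by convert h3 using 1; ring
    exact_mod_cast (ZMod.natCast_eq_zero_iff _ _).mpr this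

theorem card_mul_mul_eq_zero_le (q : ℕ) [NeZero q] :
    (Finset.univ.filter fun p : ZMod q × ZMod q × ZMod q => p.1 * p.2.1 * p.2.2 = 0).card
      ≤ q ^ 2 * q.divisors.card ^ 2 := by
  classical
  have hq : 0 < q := NeZero.pos q
  let A : ℕ → Finset (ZMod q) := fun e => Finset.univ.filter fun x : ZMod q => (e : ZMod q) * x = 0
  have hA : ∀ e : ℕ, e ≠ 0 → (A e).card ≤ e := fun e he => by
    have := card_filter_intCast_mul_eq_le q (m := (e : ℤ)) (by exact_mod_cast he) 0
    rwa [Int.cast_natCast] at this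
  calc _ ≤ ((q.divisors ×ˢ q.divisors).biUnion fun d => A (q / d.1) ×ˢ A (q / d.2) ×ˢ A (d.1 * d.2)).card := by
        refine Finset.card_le_card fun p hp => ?_
        obtain ⟨d₁, h₁, d₂, h₂, h3⟩ := exists_divisors_of_mul_mul_eq_zero q p.1 p.2.1 p.2.2 (by simpa using hp)
        simp only [Finset.mem_biUnion, Finset.mem_product, A, Finset.mem_filter, Finset.mem_univ, true_and]
        exact ⟨(d₁, d₂), ⟨h₁, h₂⟩, h3⟩
    _ ≤ ∑ d ∈ q.divisors ×ˢ q.divisors, (A (q / d.1) ×ˢ A (q / d.2) ×ˢ A (d.1 * d.2)).card :=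
        Finset.card_biUnion_le
    _ ≤ ∑ d ∈ q.divisors ×ˢ q.divisors, q ^ 2 := by
        refine Finset.sum_le_sum fun d hd => ?_
        obtain ⟨h1, h2⟩ := Finset.mem_product.mp hd
        obtain ⟨c1, hc1⟩ := Nat.dvd_of_mem_divisors h1
        obtain ⟨c2, hc2⟩ := Nat.dvd_of_mem_divisors h2
        have p1 := Nat.pos_of_mem_divisors h1
        have p2 := Nat.pos_of_mem_divisors h2
        have e1 : q / d.1 = c1 := by rw [hc1]; exact Nat.mul_div_cancel_left _ p1
        have e2 : q / d.2 = c2 := by rw [hc2]; exact Nat.mul_div_cancel_left _ p2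
        have c1p : c1 ≠ 0 := by rintro rfl; omega
        have c2p : c2 ≠ 0 := by rintro rfl; omega
        rw [Finset.card_product, Finset.card_product, e1, e2]
        calc _ ≤ c1 * (c2 * (d.1 * d.2)) := by
              gcongr
              · exact hA _ c1p
              · exact hA _ c2p
              · exact hA _ (by positivity)
          _ = (d.1 * c1) * (d.2 * c2) := by ring
          _ = q ^ 2 := by rw [← hc1, ← hc2]; ring
    _ = _ := by simp [Finset.card_product]; ring

theorem card_unit_sums_le (q : ℕ) [NeZero q] :
    (Finset.univ.filter fun p : ((ZMod q)ˣ × (ZMod q)ˣ) × ((ZMod q)ˣ × (ZMod q)ˣ) =>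
      (p.1.1 : ZMod q) + p.1.2 = p.2.1 + p.2.2 ∧
      ((p.1.1⁻¹ : (ZMod q)ˣ) : ZMod q) + (p.1.2⁻¹ : (ZMod q)ˣ)
        = (p.2.1⁻¹ : (ZMod q)ˣ) + (p.2.2⁻¹ : (ZMod q)ˣ)).card
      ≤ 2 * (q ^ 2 * q.divisors.card ^ 2) := by
  classical
  let f : ((ZMod q)ˣ × (ZMod q)ˣ) × ((ZMod q)ˣ × (ZMod q)ˣ) → ZMod q × ZMod q × ZMod q :=
    fun p => (p.1.1 + p.1.2, p.2.1 - p.1.1, p.2.1 - p.1.2)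
  refine (Finset.card_le_mul_card_image_of_maps_to (f := f)
    (t := Finset.univ.filter fun p : ZMod q × ZMod q × ZMod q => p.1 * p.2.1 * p.2.2 = 0) ?_ 2 ?_).trans
    (Nat.mul_le_mul_left _ (card_mul_mul_eq_zero_le q))
  · rintro ⟨⟨a, b⟩, ⟨c, d⟩⟩ h
    simp only [Finset.mem_filter, Finset.mem_univ, true_and, f] at h ⊢
    obtain ⟨h1, h2⟩ := h
    have ha := a.mul_inv
    have hb := b.mul_inv
    have hc := c.mul_inv
    have hd := d.mul_inv
    have hd' : (d : ZMod q) = a + b - c := by rw [h1]; ring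
    have e1 : ((a : ZMod q) + b) * (c * d) = (c + d) * (a * b) := by
      linear_combination (a * b * c * d : ZMod q) * h2 - (b * c * d : ZMod q) * ha - (a * c * d : ZMod q) * hb + (a * b * d : ZMod q) * hc + (a * b * c : ZMod q) * hd
    rw [← h1, hd'] at e1
    linear_combination -e1
  · rintro ⟨s, u, v⟩ _
    refine le_trans (Finset.card_le_card_of_injOn (fun p => (p.1.1 : ZMod q)) ?_ ?_)
      (card_filter_intCast_mul_eq_le q (m := 2) (by norm_num) (s + v - u))
    · rintro ⟨⟨a, b⟩, ⟨c, d⟩⟩ h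
      simp only [Finset.coe_filter, Set.mem_ofPred_eq, Finset.mem_filter, Finset.mem_univ, true_and, f, Prod.mk.injEq] at h ⊢
      obtain ⟨_, h1, h2, h3⟩ := h
      push_cast
      linear_combination h1 - h2 + h3
    · rintro ⟨⟨a, b⟩, ⟨c, d⟩⟩ h ⟨⟨a', b'⟩, ⟨c', d'⟩⟩ h' haa
      simp only [Finset.coe_filter, Set.mem_ofPred_eq, Finset.mem_filter, Finset.mem_univ, true_and, f, Prod.mk.injEq] at h h' haa
      obtain ⟨⟨k1, _⟩, h1, h2, h3⟩ := h
      obtain ⟨⟨k1', _⟩, h1', h2', h3'⟩ := h'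
      have hb : (b : ZMod q) = b' := by linear_combination h1 - h1' - haa
      have hc : (c : ZMod q) = c' := by linear_combination h2 - h2' + haa
      have hd : (d : ZMod q) = d' := by linear_combination k1' - k1 + haa + hb - hc
      rw [Units.ext haa, Units.ext hb, Units.ext hc, Units.ext hd]

open Complex in
theorem sum_norm_sq_charSum {q : ℕ} [NeZero q] {ι : Type*} [Fintype ι] (v w : ι → ZMod q) :
    ∑ p : ZMod q × ZMod q, ‖∑ i, ZMod.stdAddChar (p.1 * v i + p.2 * w i)‖ ^ 2
      = q ^ 2 * (Finset.univ.filter fun x : ι × ι => v x.1 = v x.2 ∧ w x.1 = w x.2).card := by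
  classical
  have hstar : ∀ x : ZMod q, (starRingEnd ℂ) (ZMod.stdAddChar x) = ZMod.stdAddChar (-x) := by
    intro x; rw [AddChar.map_neg_eq_conj]
  have hp := ZMod.isPrimitive_stdAddChar q
  apply Complex.ofReal_injective
  push_cast
  have h1 : ∀ p : ZMod q × ZMod q, ((‖∑ i, ZMod.stdAddChar (p.1 * v i + p.2 * w i)‖ : ℂ)) ^ 2
      = ∑ x : ι × ι, ZMod.stdAddChar (p.1 * (v x.1 - v x.2)) * ZMod.stdAddChar (p.2 * (w x.1 - w x.2)) := by
    intro p
    rw [← Complex.mul_conj', map_sum, Finset.sum_mul_sum, Fintype.sum_prod_type]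
    refine Finset.sum_congr rfl fun i _ => Finset.sum_congr rfl fun j _ => ?_
    rw [hstar, ← AddChar.map_add_eq_mul, ← AddChar.map_add_eq_mul]
    congr 1; ring
  simp_rw [h1]
  rw [Finset.sum_comm]
  have h2 : ∀ x : ι × ι, ∑ p : ZMod q × ZMod q, (ZMod.stdAddChar (p.1 * (v x.1 - v x.2)) : ℂ) * ZMod.stdAddChar (p.2 * (w x.1 - w x.2))
      = if v x.1 = v x.2 ∧ w x.1 = w x.2 then (q : ℂ) ^ 2 else 0 := by
    intro x
    rw [Fintype.sum_prod_type]
    dsimp only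
    rw [← Finset.sum_mul_sum, AddChar.sum_mulShift _ hp, AddChar.sum_mulShift _ hp]
    simp only [sub_eq_zero, ZMod.card]
    split_ifs <;> simp_all [sq]
  simp_rw [h2]
  rw [← Finset.sum_filter, Finset.sum_const, nsmul_eq_mul, mul_comm]

/-- The Kloosterman sum `S(m, n; q)`. -/
def kloosterman (q : ℕ) [NeZero q] (m n : ZMod q) : ℂ :=
  ∑ b : (ZMod q)ˣ, ZMod.stdAddChar (m * (b : ZMod q) + n * ((b⁻¹ : (ZMod q)ˣ) : ZMod q))

theorem sum_norm_kloosterman_pow_four_le (q : ℕ) [NeZero q] :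
    ∑ p : ZMod q × ZMod q, ‖kloosterman q p.1 p.2‖ ^ 4 ≤ 2 * q ^ 4 * (q.divisors.card : ℝ) ^ 2 := by
  have h := sum_norm_sq_charSum (q := q) (ι := (ZMod q)ˣ × (ZMod q)ˣ) (fun x => (x.1 : ZMod q) + (x.2 : ZMod q))
    (fun x => ((x.1⁻¹ : (ZMod q)ˣ) : ZMod q) + ((x.2⁻¹ : (ZMod q)ˣ) : ZMod q))
  have h1 : ∀ p : ZMod q × ZMod q, ‖kloosterman q p.1 p.2‖ ^ 4 =
      ‖∑ i : (ZMod q)ˣ × (ZMod q)ˣ, ZMod.stdAddChar (p.1 * ((i.1 : ZMod q) + (i.2 : ZMod q)) + p.2 * (((i.1⁻¹ : (ZMod q)ˣ) : ZMod q) + ((i.2⁻¹ : (ZMod q)ˣ) : ZMod q)))‖ ^ 2 := by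
    intro p
    rw [show 4 = 2 * 2 from rfl, pow_mul, ← norm_pow, kloosterman, sq (∑ b : (ZMod q)ˣ, _), Finset.sum_mul_sum, Fintype.sum_prod_type]
    congr 2
    refine Finset.sum_congr rfl fun i _ => Finset.sum_congr rfl fun j _ => ?_
    rw [← AddChar.map_add_eq_mul]
    congr 1; ring
  simp_rw [h1]
  rw [h]
  have := card_unit_sums_le q
  calc _ ≤ (q : ℝ) ^ 2 * ((2 * (q ^ 2 * q.divisors.card ^ 2) : ℕ) : ℝ) := by
        gcongr
    _ = _ := by push_cast; ring

theorem kloosterman_mul_unit (q : ℕ) [NeZero q] (m n : ZMod q) (u : (ZMod q)ˣ) :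
    kloosterman q (m * u) (n * (u⁻¹ : (ZMod q)ˣ)) = kloosterman q m n := by
  unfold kloosterman
  refine Fintype.sum_equiv (Equiv.mulLeft u) _ _ fun b => ?_
  congr 1
  simp only [Equiv.coe_mulLeft, mul_inv, Units.val_mul]
  ring

theorem kloosterman_comm (q : ℕ) [NeZero q] (m n : ZMod q) :
    kloosterman q m n = kloosterman q n m := by
  unfold kloosterman
  refine Fintype.sum_equiv (Equiv.inv _) _ _ fun b => ?_
  simp [add_comm]

theorem totient_mul_norm_kloosterman_pow_four_le (q : ℕ) [NeZero q] {m : ℤ} (hm : m ≠ 0) (n : ZMod q) :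
    (q.totient : ℝ) * ‖kloosterman q m n‖ ^ 4 ≤ m.natAbs * (2 * q ^ 4 * (q.divisors.card : ℝ) ^ 2) := by
  classical
  refine le_trans ?_ (mul_le_mul_of_nonneg_left (sum_norm_kloosterman_pow_four_le q) (by positivity))
  let f : (ZMod q)ˣ → ZMod q × ZMod q := fun u => (m * u, n * (u⁻¹ : (ZMod q)ˣ))
  calc (q.totient : ℝ) * ‖kloosterman q m n‖ ^ 4
      = ∑ u : (ZMod q)ˣ, ‖kloosterman q (f u).1 (f u).2‖ ^ 4 := by
        simp [f, kloosterman_mul_unit, ZMod.card_units_eq_totient]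
    _ = ∑ p : ZMod q × ZMod q, ∑ u : (ZMod q)ˣ with f u = p, ‖kloosterman q (f u).1 (f u).2‖ ^ 4 :=
        (Finset.sum_fiberwise _ _ _).symm
    _ ≤ ∑ p : ZMod q × ZMod q, m.natAbs * ‖kloosterman q p.1 p.2‖ ^ 4 := by
        refine Finset.sum_le_sum fun p _ => ?_
        rw [Finset.sum_congr rfl (g := fun _ => ‖kloosterman q p.1 p.2‖ ^ 4)
          (fun u hu => by rw [(Finset.mem_filter.mp hu).2]), Finset.sum_const, nsmul_eq_mul]
        gcongr
        refine le_trans (Finset.card_le_card_of_injOn (fun u => (u : ZMod q)) ?_ ?_)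
          (card_filter_intCast_mul_eq_le q hm p.1)
        · intro u hu
          simp only [Finset.coe_filter, Set.mem_ofPred_eq, Finset.mem_univ, true_and, f] at hu ⊢
          rw [← hu]
        · intro u _ v _ h
          exact Units.ext h
    _ = _ := by rw [Finset.mul_sum]

theorem le_card_divisors_mul_totient (q : ℕ) : q ≤ q.divisors.card * q.totient := by
  rcases Nat.eq_zero_or_pos q with rfl | hq
  · simp
  · calc q = ∑ d ∈ q.divisors, d.totient := (Nat.sum_totient q).symm
      _ ≤ ∑ d ∈ q.divisors, q.totient := Finset.sum_le_sum fun d hd =>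
          Nat.le_of_dvd (Nat.totient_pos.mpr hq) (Nat.totient_dvd_of_dvd (Nat.dvd_of_mem_divisors hd))
      _ = _ := by simp

theorem norm_kloosterman_le (q : ℕ) [NeZero q] {m n : ℤ} (hmn : m ≠ 0 ∨ n ≠ 0) :
    ‖kloosterman q m n‖ ≤ 2 * (m.natAbs + n.natAbs : ℝ) * (q.divisors.card : ℝ) * (q : ℝ) ^ (3 / 4 : ℝ) := by
  have hq : (0 : ℝ) < q := by exact_mod_cast NeZero.pos q
  set d : ℝ := (q.divisors.card : ℝ) with hd
  have hd1 : 1 ≤ d := by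
    rw [hd]; exact_mod_cast Finset.card_pos.mpr ⟨1, Nat.one_mem_divisors.mpr (NeZero.ne q)⟩
  have main : (q.totient : ℝ) * ‖kloosterman q m n‖ ^ 4 ≤ (m.natAbs + n.natAbs : ℝ) * (2 * q ^ 4 * d ^ 2) := by
    by_cases hm : m = 0
    · have hn : n ≠ 0 := by tauto
      rw [kloosterman_comm]
      refine (totient_mul_norm_kloosterman_pow_four_le q hn _).trans ?_
      gcongr; simp
    · refine (totient_mul_norm_kloosterman_pow_four_le q hm _).trans ?_
      gcongr; simp
  have hk1 : (1 : ℝ) ≤ m.natAbs + n.natAbs := by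
    have : 1 ≤ m.natAbs + n.natAbs := by omega
    exact_mod_cast this
  set k : ℝ := m.natAbs + n.natAbs with hk
  have hφ : (q : ℝ) ≤ d * q.totient := by rw [hd]; exact_mod_cast le_card_divisors_mul_totient q
  have h4 : ‖kloosterman q m n‖ ^ 4 ≤ 2 * k * d ^ 3 * q ^ 3 := by
    have : (q : ℝ) * ‖kloosterman q m n‖ ^ 4 ≤ q * (2 * k * d ^ 3 * q ^ 3) := by
      calc (q : ℝ) * ‖kloosterman q m n‖ ^ 4 ≤ (d * q.totient) * ‖kloosterman q m n‖ ^ 4 := by gcongr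
        _ = d * (q.totient * ‖kloosterman q m n‖ ^ 4) := by ring
        _ ≤ d * (k * (2 * q ^ 4 * d ^ 2)) := by gcongr
        _ = _ := by ring
    exact le_of_mul_le_mul_left this hq
  refine le_of_pow_le_pow_left₀ (n := 4) (by norm_num) (by positivity) (h4.trans ?_)
  have : ((q : ℝ) ^ (3 / 4 : ℝ)) ^ 4 = q ^ 3 := by
    rw [← Real.rpow_natCast, ← Real.rpow_mul hq.le, ← Real.rpow_natCast]; norm_num
  rw [mul_pow, mul_pow, mul_pow, this]
  gcongr
  · norm_num
  · exact le_self_pow₀ hk1 (by norm_num)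
  · norm_num

theorem sum_range_succ_eq_sum_Ioc {M : Type*} [AddCommMonoid M] (f : ℕ → M) (N : ℕ) :
    ∑ q ∈ Finset.range N, f (q + 1) = ∑ n ∈ Finset.Ioc 0 N, f n := by
  induction N with
  | zero => simp
  | succ N ih => rw [Finset.sum_range_succ, ih, Finset.sum_Ioc_succ_top (Nat.zero_le N)]

theorem sum_card_divisors_le (N : ℕ) :
    ∑ q ∈ Finset.range N, ((q + 1).divisors.card : ℝ) ≤ N * (1 + Real.log N) := by
  have h := ArithmeticFunction.sum_Ioc_sigma0_eq_sum_div N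
  have h1 : ∑ q ∈ Finset.range N, ((q + 1).divisors.card : ℝ) =
      ∑ n ∈ Finset.Ioc 0 N, ((N / n : ℕ) : ℝ) := by
    rw [← Nat.cast_sum (Finset.Ioc 0 N), ← h, Nat.cast_sum,
      sum_range_succ_eq_sum_Ioc (fun n => (n.divisors.card : ℝ))]
    simp [ArithmeticFunction.sigma_zero_apply]
  rw [h1]
  have h2 := harmonic_le_one_add_log N
  rw [harmonic_eq_sum_Icc] at h2
  push_cast at h2
  calc _ ≤ ∑ n ∈ Finset.Ioc 0 N, (N : ℝ) * (n : ℝ)⁻¹ := by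
        refine Finset.sum_le_sum fun n _ => ?_
        rw [← div_eq_mul_inv]
        exact Nat.cast_div_le
    _ ≤ _ := by
        rw [← Finset.mul_sum]
        exact mul_le_mul_of_nonneg_left h2 (Nat.cast_nonneg _)

theorem tendsto_sum_norm_kloosterman {m n : ℤ} (hmn : m ≠ 0 ∨ n ≠ 0) :
    Tendsto (fun N : ℕ => (∑ q ∈ Finset.range N, ‖kloosterman (q + 1) m n‖) / (N : ℝ) ^ 2)
      atTop (𝓝 0) := by
  set K : ℝ := 2 * (m.natAbs + n.natAbs : ℝ)
  have hK : 0 ≤ K := by positivity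
  have hlim : Tendsto (fun x : ℝ => K * (x ^ (-(1 / 4) : ℝ) + Real.log x / x ^ (1 / 4 : ℝ)))
      atTop (𝓝 0) := by
    have h1 := tendsto_rpow_neg_atTop (show (0 : ℝ) < 1 / 4 by norm_num)
    have h2 := (isLittleO_log_rpow_atTop (show (0 : ℝ) < 1 / 4 by norm_num)).tendsto_div_nhds_zero
    simpa using (h1.add h2).const_mul K
  refine squeeze_zero' (.of_forall fun N => by positivity) ?_
    (hlim.comp tendsto_natCast_atTop_atTop)
  filter_upwards [eventually_gt_atTop 0] with N hN
  have hN' : (0 : ℝ) < N := by exact_mod_cast hN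
  simp only [Function.comp]
  rw [div_le_iff₀ (by positivity)]
  calc _ ≤ ∑ q ∈ Finset.range N, K * (N : ℝ) ^ (3 / 4 : ℝ) * ((q + 1).divisors.card : ℝ) := by
        refine Finset.sum_le_sum fun q hq => (norm_kloosterman_le (q + 1) hmn).trans ?_
        have : ((q + 1 : ℕ) : ℝ) ≤ N := by exact_mod_cast Finset.mem_range.1 hq
        calc _ ≤ K * ((q + 1).divisors.card : ℝ) * (N : ℝ) ^ (3 / 4 : ℝ) := by gcongr
          _ = _ := by ring
    _ ≤ K * (N : ℝ) ^ (3 / 4 : ℝ) * (N * (1 + Real.log N)) := by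
        rw [← Finset.mul_sum]
        exact mul_le_mul_of_nonneg_left (sum_card_divisors_le N) (by positivity)
    _ = _ := by
        have e1 : (N : ℝ) ^ (3 / 4 : ℝ) * N = (N : ℝ) ^ (-(1 / 4) : ℝ) * N ^ 2 := by
          rw [← Real.rpow_natCast, ← Real.rpow_add hN', ← Real.rpow_add_one hN'.ne']; norm_num
        have e2 : Real.log N / (N : ℝ) ^ (1 / 4 : ℝ) = Real.log N * (N : ℝ) ^ (-(1 / 4) : ℝ) := by
          rw [Real.rpow_neg hN'.le, div_eq_mul_inv]
        rw [e2]
        linear_combination (K * (1 + Real.log N)) * e1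

theorem sum_Ioc_pow_le (R k : ℕ) : ∑ e ∈ Finset.Ioc 0 R, (e : ℝ) ^ k ≤ (R : ℝ) ^ (k + 1) := by
  calc _ ≤ ∑ e ∈ Finset.Ioc 0 R, (R : ℝ) ^ k := by
        refine Finset.sum_le_sum fun e he => ?_
        have : (e : ℝ) ≤ R := by exact_mod_cast (Finset.mem_Ioc.1 he).2
        gcongr
    _ = _ := by simp [pow_succ, mul_comm]

theorem tendsto_sum_Ioc_pow_div (k : ℕ) :
    Tendsto (fun R : ℕ => (∑ e ∈ Finset.Ioc 0 R, (e : ℝ) ^ k) / (R : ℝ) ^ (k + 1)) atTop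
      (𝓝 (1 / (k + 1))) := by
  have hmono (n : ℕ) : MonotoneOn (fun x : ℝ => x ^ k) (Set.Icc 0 (0 + (n : ℝ))) :=
    fun x hx y _ hxy => pow_le_pow_left₀ hx.1 hxy k
  have hint (n : ℕ) : ∫ x in (0 : ℝ)..0 + (n : ℝ), x ^ k = (n : ℝ) ^ (k + 1) / (k + 1) := by
    simp
  have hup : Tendsto (fun R : ℕ => (1 + 1 / (R : ℝ)) ^ (k + 1) / (k + 1)) atTop
      (𝓝 (1 / (k + 1))) := by
    have := ((tendsto_one_div_atTop_nhds_zero_nat (𝕜 := ℝ)).const_add 1).pow (k + 1)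
    simpa using this.div_const ((k : ℝ) + 1)
  refine tendsto_of_tendsto_of_tendsto_of_le_of_le' tendsto_const_nhds hup ?_ ?_
  · filter_upwards [eventually_gt_atTop 0] with R hR
    have hR' : (0 : ℝ) < R := by exact_mod_cast hR
    have := (hmono R).integral_le_sum
    rw [hint] at this
    simp only [zero_add] at this
    rw [sum_range_succ_eq_sum_Ioc (fun e : ℕ => (e : ℝ) ^ k)] at this
    rw [le_div_iff₀ (by positivity)]
    linarith [this, show 1 / ((k : ℝ) + 1) * R ^ (k + 1) = (R : ℝ) ^ (k + 1) / (k + 1) by ring]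
  · filter_upwards [eventually_gt_atTop 0] with R hR
    have hR' : (0 : ℝ) < R := by exact_mod_cast hR
    have := (hmono (R + 1)).sum_le_integral
    rw [hint, Finset.sum_range_succ'] at this
    simp only [zero_add] at this
    rw [sum_range_succ_eq_sum_Ioc (fun e : ℕ => (e : ℝ) ^ k)] at this
    rw [div_le_iff₀ (by positivity)]
    have e : (1 + 1 / (R : ℝ)) ^ (k + 1) / (k + 1) * R ^ (k + 1) =
        ((R + 1 : ℕ) : ℝ) ^ (k + 1) / (k + 1) := by
      rw [div_mul_eq_mul_div, ← mul_pow]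
      congr 2
      push_cast
      field_simp
    rw [e]
    exact (le_add_of_nonneg_right (by positivity)).trans this

/-- The density constant `∑ μ(d) / d² = 6 / π²`. -/
def moebiusConst : ℝ := ∑' d : ℕ, (ArithmeticFunction.moebius d : ℝ) / (d : ℝ) ^ 2

theorem norm_moebius_div_le (d : ℕ) :
    ‖(ArithmeticFunction.moebius d : ℝ) / (d : ℝ) ^ 2‖ ≤ 1 / (d : ℝ) ^ 2 := by
  rw [norm_div, Real.norm_eq_abs, norm_pow, Real.norm_natCast]
  gcongr
  exact_mod_cast ArithmeticFunction.abs_moebius_le_one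

theorem moebiusConst_pos : 0 < moebiusConst := by
  have h2 := hasSum_zeta_two
  have hs : Summable fun d : ℕ => (ArithmeticFunction.moebius d : ℝ) / (d : ℝ) ^ 2 :=
    .of_norm_bounded h2.summable norm_moebius_div_le
  have h1 : HasSum (fun d : ℕ => if d = 1 then (1 : ℝ) else 0) 1 := hasSum_ite_eq 1 1
  have h3 : ∑' d : ℕ, ((ArithmeticFunction.moebius d : ℝ) / (d : ℝ) ^ 2 -
      if d = 1 then (1 : ℝ) else 0) = moebiusConst - 1 := (hs.hasSum.sub h1).tsum_eq
  have h4 : ‖moebiusConst - 1‖ ≤ Real.pi ^ 2 / 6 - 1 := by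
    rw [← h3]
    refine tsum_of_norm_bounded (h2.sub h1) fun d => ?_
    by_cases hd : d = 1
    · simp [hd]
    · simpa [hd] using norm_moebius_div_le d
  have h5 : Real.pi ^ 2 / 6 - 1 < 1 := by nlinarith [Real.pi_lt_d2, Real.pi_pos]
  have := (abs_le.1 h4).1
  linarith

theorem sum_totient_mul_pow (k N : ℕ) :
    ∑ n ∈ Finset.Ioc 0 N, (n.totient : ℝ) * (n : ℝ) ^ k =
      ∑ d ∈ Finset.Ioc 0 N, ((ArithmeticFunction.moebius d : ℝ) * (d : ℝ) ^ k) *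
        ∑ e ∈ Finset.Ioc 0 (N / d), (e : ℝ) ^ (k + 1) := by
  let f : ArithmeticFunction ℝ := ⟨fun d => (ArithmeticFunction.moebius d : ℝ) * (d : ℝ) ^ k, by simp⟩
  let g : ArithmeticFunction ℝ := ⟨fun e => (e : ℝ) ^ (k + 1), by simp⟩
  refine Eq.trans (Finset.sum_congr rfl fun n hn => ?_)
    (ArithmeticFunction.sum_Ioc_mul_eq_sum_sum f g N)
  have hn0 : 0 < n := (Finset.mem_Ioc.1 hn).1
  have h := (ArithmeticFunction.sum_eq_iff_sum_mul_moebius_eq (R := ℝ)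
    (f := fun n => (n.totient : ℝ)) (g := fun n => (n : ℝ))).1
    (fun n _ => by exact_mod_cast Nat.sum_totient n) n hn0
  rw [ArithmeticFunction.mul_apply, ← h, Finset.sum_mul]
  refine Finset.sum_congr rfl fun x hx => ?_
  have hx' : (n : ℝ) = x.1 * x.2 := by exact_mod_cast (Nat.mem_divisorsAntidiagonal.1 hx).1.symm
  change _ = (ArithmeticFunction.moebius x.1 : ℝ) * (x.1 : ℝ) ^ k * (x.2 : ℝ) ^ (k + 1)
  rw [hx']
  ring

theorem tendsto_sum_totient_mul_pow (k : ℕ) :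
    Tendsto (fun N : ℕ => (∑ n ∈ Finset.Ioc 0 N, (n.totient : ℝ) * (n : ℝ) ^ k) / (N : ℝ) ^ (k + 2))
      atTop (𝓝 (moebiusConst / (k + 2))) := by
  let F : ℕ → ℕ → ℝ := fun N d => ((ArithmeticFunction.moebius d : ℝ) * (d : ℝ) ^ k) *
    (∑ e ∈ Finset.Ioc 0 (N / d), (e : ℝ) ^ (k + 1)) / (N : ℝ) ^ (k + 2)
  have hF (N : ℕ) : (∑ n ∈ Finset.Ioc 0 N, (n.totient : ℝ) * (n : ℝ) ^ k) / (N : ℝ) ^ (k + 2) =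
      ∑' d, F N d := by
    rw [sum_totient_mul_pow, Finset.sum_div, tsum_eq_sum]
    intro d hd
    have : N / d = 0 := by
      rcases Nat.eq_zero_or_pos d with rfl | h0
      · simp
      · exact Nat.div_eq_of_lt (by simp at hd; omega)
    simp [F, this]
  simp_rw [hF]
  have hlim : moebiusConst / (k + 2) =
      ∑' d : ℕ, (ArithmeticFunction.moebius d : ℝ) / (d : ℝ) ^ 2 / (k + 2) := by
    rw [moebiusConst, tsum_div_const]
  rw [hlim]
  refine tendsto_tsum_of_dominated_convergence hasSum_zeta_two.summable (fun d => ?_)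
    ((eventually_gt_atTop 0).mono fun N hN d => ?_)
  · rcases Nat.eq_zero_or_pos d with rfl | hd
    · simp [F]
    have hd' : (0 : ℝ) < d := by exact_mod_cast hd
    have h1 : Tendsto (fun N : ℕ => N / d) atTop atTop := Nat.tendsto_div_const_atTop hd.ne'
    have h2 := (tendsto_sum_Ioc_pow_div (k + 1)).comp h1
    have h3 : Tendsto (fun N : ℕ => ((N / d : ℕ) : ℝ) / N) atTop (𝓝 (1 / d)) := by
      have : Tendsto (fun N : ℕ => (N : ℝ) / d) atTop atTop :=
        tendsto_natCast_atTop_atTop.atTop_div_const hd'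
      have h4 := ((tendsto_nat_floor_div_atTop (R := ℝ)).comp this).div_const (d : ℝ)
      refine h4.congr' ?_
      filter_upwards [eventually_gt_atTop 0] with N hN
      have hN' : (0 : ℝ) < N := by exact_mod_cast hN
      simp only [Function.comp, Nat.floor_div_eq_div]
      field_simp
    have h5 := (h2.mul (h3.pow (k + 2))).const_mul ((ArithmeticFunction.moebius d : ℝ) * (d : ℝ) ^ k)
    have e : (ArithmeticFunction.moebius d : ℝ) / (d : ℝ) ^ 2 / (k + 2) =
        (ArithmeticFunction.moebius d : ℝ) * (d : ℝ) ^ k *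
          (1 / (((k + 1 : ℕ) : ℝ) + 1) * (1 / (d : ℝ)) ^ (k + 2)) := by
      push_cast
      rw [show (k : ℝ) + 1 + 1 = k + 2 by ring, _root_.one_div_pow, pow_add]
      field_simp
    rw [e]
    refine h5.congr' ?_
    filter_upwards [h1.eventually (eventually_gt_atTop 0), eventually_gt_atTop 0] with N hN hN0
    have hN' : (0 : ℝ) < N := by exact_mod_cast hN0
    have hN'' : (0 : ℝ) < (N / d : ℕ) := by exact_mod_cast hN
    simp only [Function.comp, F]
    rw [div_pow]
    field_simp
  · have hN' : (0 : ℝ) < N := by exact_mod_cast hN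
    rcases Nat.eq_zero_or_pos d with rfl | hd
    · simp [F]
    have hd' : (0 : ℝ) < d := by exact_mod_cast hd
    have h0 : (0 : ℝ) ≤ ∑ e ∈ Finset.Ioc 0 (N / d), (e : ℝ) ^ (k + 1) := by positivity
    have h1 : ∑ e ∈ Finset.Ioc 0 (N / d), (e : ℝ) ^ (k + 1) ≤ ((N : ℝ) / d) ^ (k + 2) :=
      (sum_Ioc_pow_le _ _).trans (pow_le_pow_left₀ (by positivity) Nat.cast_div_le _)
    have h2 : |(ArithmeticFunction.moebius d : ℝ)| ≤ 1 := by
      exact_mod_cast ArithmeticFunction.abs_moebius_le_one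
    rw [Real.norm_eq_abs, abs_div, abs_mul, abs_mul, abs_of_nonneg h0,
      abs_of_pos (show (0 : ℝ) < (N : ℝ) ^ (k + 2) by positivity),
      abs_of_pos (show (0 : ℝ) < (d : ℝ) ^ k by positivity), div_le_iff₀ (by positivity)]
    calc _ ≤ 1 * (d : ℝ) ^ k * ((N : ℝ) / d) ^ (k + 2) := by gcongr
      _ = _ := by rw [div_pow, pow_add (d : ℝ)]; field_simp

/-- Parameter space with coordinates `((1/T, a/T), (b/a mod 1, c/a mod 1))`. -/
abbrev ParamSpace := (unitInterval × unitInterval) × (UnitAddCircle × UnitAddCircle)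

/-- Matrices with upper left entry in `[1, T]`, up to integral translations of `b/a` and `c/a`. -/
def unitIndex (T : ℝ) : Finset (Σ n : ℕ, (ZMod (n + 1))ˣ) :=
  (Finset.range ⌊T⌋₊).sigma fun _ => Finset.univ

/-- The point of the parameter space attached to a residue class. -/
def paramPoint (T : ℝ) (i : Σ n : ℕ, (ZMod (n + 1))ˣ) : ParamSpace :=
  ((Set.projIcc 0 1 zero_le_one (1 / T), Set.projIcc 0 1 zero_le_one (((i.1 + 1 : ℕ) : ℝ) / T)),
    (ZMod.toAddCircle (i.2 : ZMod (i.1 + 1)),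
      ZMod.toAddCircle (-((i.2⁻¹ : (ZMod (i.1 + 1))ˣ) : ZMod (i.1 + 1)))))

/-- Monomials spanning a dense subalgebra of the continuous functions. -/
def paramMonomial (p : (ℕ × ℕ) × (ℤ × ℤ)) : BoundedContinuousFunction ParamSpace ℂ :=
  BoundedContinuousFunction.mkOfCompact
    ⟨fun z => ((z.1.1 : ℝ) : ℂ) ^ p.1.1 * ((z.1.2 : ℝ) : ℂ) ^ p.1.2 *
      (fourier p.2.1 z.2.1 * fourier p.2.2 z.2.2), by fun_prop⟩

theorem paramMonomial_apply (p : (ℕ × ℕ) × (ℤ × ℤ)) (z : ParamSpace) :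
    paramMonomial p z = ((z.1.1 : ℝ) : ℂ) ^ p.1.1 * ((z.1.2 : ℝ) : ℂ) ^ p.1.2 *
      (fourier p.2.1 z.2.1 * fourier p.2.2 z.2.2) := rfl

theorem card_unitIndex (T : ℝ) :
    ((unitIndex T).card : ℝ) = ∑ n ∈ Finset.Ioc 0 ⌊T⌋₊, (n.totient : ℝ) := by
  rw [unitIndex, Finset.card_sigma, ← sum_range_succ_eq_sum_Ioc (fun n => (n.totient : ℝ))]
  simp

theorem card_unitIndex_pos {T : ℝ} (hT : 1 ≤ T) : 0 < (unitIndex T).card := by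
  have h : 0 < ⌊T⌋₊ := Nat.floor_pos.2 hT
  exact Finset.card_pos.2 ⟨⟨0, 1⟩, by simp only [unitIndex, Finset.mem_sigma, Finset.mem_range, h,
    Finset.mem_univ, and_self]⟩

theorem tendsto_sum_totient_mul_pow_real (k : ℕ) :
    Tendsto (fun T : ℝ => (∑ n ∈ Finset.range ⌊T⌋₊,
      (((n + 1).totient : ℝ) * (((n + 1 : ℕ) : ℝ) / T) ^ k)) / T ^ 2) atTop
      (𝓝 (moebiusConst / (k + 2))) := by
  have h1 := (tendsto_sum_totient_mul_pow k).comp (tendsto_nat_floor_atTop (α := ℝ))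
  have h2 := (tendsto_nat_floor_div_atTop (R := ℝ)).pow (k + 2)
  have h3 := h1.mul h2
  rw [one_pow, mul_one] at h3
  refine h3.congr' ?_
  filter_upwards [eventually_ge_atTop 1] with T hT
  have hT0 : (0 : ℝ) < T := by linarith
  have hN : (0 : ℝ) < ⌊T⌋₊ := by exact_mod_cast Nat.floor_pos.2 hT
  rw [sum_range_succ_eq_sum_Ioc (fun n => (n.totient : ℝ) * ((n : ℝ) / T) ^ k)]
  simp only [Function.comp, div_pow]
  simp_rw [← mul_div_assoc]
  rw [← Finset.sum_div]
  field_simp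
  ring

theorem tendsto_card_unitIndex :
    Tendsto (fun T : ℝ => ((unitIndex T).card : ℝ) / T ^ 2) atTop (𝓝 (moebiusConst / 2)) := by
  have := tendsto_sum_totient_mul_pow_real 0
  simp only [pow_zero, mul_one, Nat.cast_zero, zero_add] at this
  simpa only [card_unitIndex, ← sum_range_succ_eq_sum_Ioc (fun n => (n.totient : ℝ))] using this

/-- The uniform probability measure on the points attached to residue classes. -/
def sampleMeasure (T : ℝ) : Measure ParamSpace :=
  ((unitIndex T).card : ENNReal)⁻¹ • ∑ i ∈ unitIndex T, Measure.dirac (paramPoint T i)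

theorem isProbabilityMeasure_sampleMeasure {T : ℝ} (hT : 1 ≤ T) :
    IsProbabilityMeasure (sampleMeasure T) := by
  constructor
  have := card_unitIndex_pos hT
  simp only [sampleMeasure, Measure.smul_apply, Measure.coe_finsetSum, Finset.sum_apply,
    measure_univ, Finset.sum_const, smul_eq_mul, nsmul_eq_mul, mul_one]
  exact ENNReal.inv_mul_cancel (by exact_mod_cast this.ne') (ENNReal.natCast_ne_top _)

/-- `sampleMeasure` as a probability measure. -/
def sampleProb (T : ℝ) : ProbabilityMeasure ParamSpace :=
  ⟨sampleMeasure (max T 1), isProbabilityMeasure_sampleMeasure (le_max_right _ _)⟩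

theorem integral_sampleMeasure (T : ℝ) (f : BoundedContinuousFunction ParamSpace ℂ) :
    ∫ z, f z ∂(sampleMeasure T) =
      (((unitIndex T).card : ℝ)⁻¹ : ℂ) * ∑ i ∈ unitIndex T, f (paramPoint T i) := by
  rw [sampleMeasure, integral_smul_measure, integral_finsetSum_measure]
  · rw [Finset.sum_congr rfl fun i _ =>
      integral_dirac' _ (paramPoint T i) f.continuous.stronglyMeasurable]
    simp
  · exact fun i _ => f.integrable _

theorem sampleMeasure_real (T : ℝ) {E : Set ParamSpace} (hE : MeasurableSet E)
    [DecidablePred (· ∈ E)] :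
    (sampleMeasure T).real E =
      (((unitIndex T).filter fun i => paramPoint T i ∈ E).card : ℝ) / (unitIndex T).card := by
  classical
  rw [Measure.real, sampleMeasure, Measure.smul_apply, Measure.coe_finsetSum, Finset.sum_apply]
  simp only [Measure.dirac_apply' _ hE, Set.indicator_apply, Pi.one_apply, Finset.sum_boole,
    smul_eq_mul, ENNReal.toReal_mul, ENNReal.toReal_inv, ENNReal.toReal_natCast]
  rw [div_eq_inv_mul]

theorem fourier_toAddCircle {q : ℕ} [NeZero q] (m : ℤ) (b : ZMod q) :
    (fourier m (ZMod.toAddCircle b) : ℂ) = ZMod.stdAddChar ((m : ZMod q) * b) := by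
  rw [fourier_apply, ZMod.stdAddChar_apply, ← map_zsmul, zsmul_eq_mul]
  rfl

theorem sum_paramMonomial {T : ℝ} (hT : 1 ≤ T) (l k : ℕ) (m n : ℤ) :
    ∑ i ∈ unitIndex T, paramMonomial ((l, k), (m, n)) (paramPoint T i) =
      ((1 / T : ℝ) : ℂ) ^ l * ∑ q ∈ Finset.range ⌊T⌋₊,
        ((((q + 1 : ℕ) : ℝ) / T : ℝ) : ℂ) ^ k * kloosterman (q + 1) m (-n : ℤ) := by
  have hT0 : (0 : ℝ) < T := by linarith
  rw [unitIndex, Finset.sum_sigma, Finset.mul_sum]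
  refine Finset.sum_congr rfl fun q hq => ?_
  have hq' : ((q + 1 : ℕ) : ℝ) ≤ T :=
    (Nat.le_floor_iff hT0.le).1 (Finset.mem_range.1 hq)
  rw [kloosterman, Finset.mul_sum, Finset.mul_sum]
  refine Finset.sum_congr rfl fun b _ => ?_
  rw [paramMonomial_apply]
  simp only [paramPoint]
  rw [fourier_toAddCircle, fourier_toAddCircle, ← AddChar.map_add_eq_mul,
    Set.projIcc_of_mem zero_le_one (show (1 / T) ∈ Set.Icc (0 : ℝ) 1 from
      ⟨by positivity, by rw [div_le_one hT0]; exact hT⟩),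
    Set.projIcc_of_mem zero_le_one (show (((q + 1 : ℕ) : ℝ) / T) ∈ Set.Icc (0 : ℝ) 1 from
      ⟨by positivity, by rw [div_le_one hT0]; exact hq'⟩)]
  simp only [mul_neg, Int.cast_neg, neg_mul]
  ring

/-- The value of the integral of a monomial against the limit measure. -/
def monomialLimit (p : (ℕ × ℕ) × (ℤ × ℤ)) : ℂ :=
  if p.1.1 = 0 ∧ p.2 = 0 then 2 / ((p.1.2 : ℂ) + 2) else 0

theorem tendsto_integral_paramMonomial (p : (ℕ × ℕ) × (ℤ × ℤ)) :
    Tendsto (fun T => ∫ z, paramMonomial p z ∂(sampleMeasure T)) atTop (𝓝 (monomialLimit p)) := by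
  obtain ⟨⟨l, k⟩, ⟨m, n⟩⟩ := p
  simp_rw [integral_sampleMeasure]
  have hC := moebiusConst_pos
  have hcard := tendsto_card_unitIndex
  by_cases hmn : m ≠ 0 ∨ n ≠ 0
  · have h0 : monomialLimit ((l, k), (m, n)) = 0 := by
      rw [monomialLimit, if_neg]; rintro ⟨-, h⟩; simp at h; tauto
    rw [h0]
    have hK := (tendsto_sum_norm_kloosterman (m := m) (n := -n) (by simpa using hmn)).comp
      (tendsto_nat_floor_atTop (α := ℝ))
    have h2 := (tendsto_nat_floor_div_atTop (R := ℝ)).pow 2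
    have h3 := (hK.mul h2).div hcard (by positivity)
    rw [zero_mul, zero_div] at h3
    refine squeeze_zero_norm' ?_ h3
    filter_upwards [eventually_ge_atTop 1] with T hT
    have hT0 : (0 : ℝ) < T := by linarith
    have hN : (0 : ℝ) < ⌊T⌋₊ := by exact_mod_cast Nat.floor_pos.2 hT
    have hc : (0 : ℝ) < (unitIndex T).card := by exact_mod_cast card_unitIndex_pos hT
    rw [sum_paramMonomial hT]
    have hb : ‖((1 / T : ℝ) : ℂ) ^ l * ∑ q ∈ Finset.range ⌊T⌋₊,
        ((((q + 1 : ℕ) : ℝ) / T : ℝ) : ℂ) ^ k * kloosterman (q + 1) m (-n : ℤ)‖ ≤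
        ∑ q ∈ Finset.range ⌊T⌋₊, ‖kloosterman (q + 1) m (-n : ℤ)‖ := by
      rw [norm_mul, norm_pow, Complex.norm_real, Real.norm_of_nonneg (by positivity)]
      have : (1 / T) ^ l ≤ 1 := pow_le_one₀ (by positivity) (by rw [div_le_one hT0]; exact hT)
      refine (mul_le_of_le_one_left (norm_nonneg _) this).trans ((norm_sum_le _ _).trans
        (Finset.sum_le_sum fun q hq => ?_))
      have hq' : ((q + 1 : ℕ) : ℝ) ≤ T :=
        (Nat.le_floor_iff hT0.le).1 (Finset.mem_range.1 hq)
      rw [norm_mul, norm_pow, Complex.norm_real, Real.norm_of_nonneg (by positivity)]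
      exact mul_le_of_le_one_left (norm_nonneg _)
        (pow_le_one₀ (by positivity) (by rw [div_le_one hT0]; exact hq'))
    rw [norm_mul, norm_inv, Complex.norm_real, Real.norm_of_nonneg hc.le]
    refine (mul_le_mul_of_nonneg_left hb (by positivity)).trans_eq ?_
    simp only [Function.comp, Pi.div_apply]
    field_simp
  push Not at hmn
  obtain ⟨rfl, rfl⟩ := hmn
  have hk := tendsto_sum_totient_mul_pow_real k
  have hmain : Tendsto (fun T : ℝ => (((1 / T) ^ l * ((∑ n ∈ Finset.range ⌊T⌋₊,
      (((n + 1).totient : ℝ) * (((n + 1 : ℕ) : ℝ) / T) ^ k)) / T ^ 2 /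
      ((unitIndex T).card / T ^ 2)) : ℝ) : ℂ)) atTop
      (𝓝 (monomialLimit ((l, k), (0, 0)))) := by
    have h4 := hk.div hcard (by positivity)
    have h5 : Tendsto (fun T : ℝ => (1 / T) ^ l) atTop (𝓝 (0 ^ l)) := by
      simpa using (tendsto_inv_atTop_zero (𝕜 := ℝ)).pow l
    have h6 : monomialLimit ((l, k), (0, 0)) =
        (((0 : ℝ) ^ l * (moebiusConst / (k + 2) / (moebiusConst / 2)) : ℝ) : ℂ) := by
      rcases Nat.eq_zero_or_pos l with rfl | hl
      · have : moebiusConst / (k + 2) / (moebiusConst / 2) = 2 / ((k : ℝ) + 2) := by field_simp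
        rw [this]
        simp [monomialLimit]
      · simp [monomialLimit, hl.ne']
    rw [h6]
    exact (Complex.continuous_ofReal.tendsto _).comp (h5.mul h4)
  refine hmain.congr' ?_
  filter_upwards [eventually_ge_atTop 1] with T hT
  have hT0 : (0 : ℝ) < T := by linarith
  have hT0' : (T : ℂ) ≠ 0 := by exact_mod_cast hT0.ne'
  have hc : ((unitIndex T).card : ℂ) ≠ 0 := by exact_mod_cast (card_unitIndex_pos hT).ne'
  rw [sum_paramMonomial hT]
  simp [kloosterman]
  field_simp
  exact Finset.sum_congr rfl fun _ _ => mul_comm _ _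

/-- The probability measure with density `2x` on `[0, 1]`. -/
def radialMeasure : Measure ℝ :=
  (volume.restrict (Set.Ioc 0 1)).withDensity fun x => ENNReal.ofReal (2 * x)

/-- The limit law of `(a/T, b/a mod 1, c/a mod 1)`. -/
def cellMeasure : Measure (ℝ × (ℝ × ℝ)) :=
  radialMeasure.prod ((volume.restrict (Set.Ico 0 1)).prod (volume.restrict (Set.Ico 0 1)))

/-- The map to the parameter space on the slice `1/T = 0`. -/
def limitMap (w : ℝ × (ℝ × ℝ)) : ParamSpace :=
  ((0, Set.projIcc 0 1 zero_le_one w.1), ((w.2.1 : UnitAddCircle), (w.2.2 : UnitAddCircle)))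

theorem continuous_limitMap : Continuous limitMap := by
  unfold limitMap
  have : Continuous (fun x : ℝ => (x : UnitAddCircle)) := AddCircle.continuous_mk' 1
  have := continuous_projIcc (h := zero_le_one (α := ℝ))
  fun_prop

theorem integral_radialMeasure (f : ℝ → ℂ) :
    ∫ x, f x ∂radialMeasure = ∫ x in (0 : ℝ)..1, (2 * x : ℝ) • f x := by
  rw [radialMeasure, integral_withDensity_eq_integral_toReal_smul (by fun_prop)
      (.of_forall fun x => ENNReal.ofReal_lt_top),
    intervalIntegral.integral_of_le zero_le_one]
  refine setIntegral_congr_fun measurableSet_Ioc fun x hx => ?_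
  rw [ENNReal.toReal_ofReal (by linarith [hx.1])]

theorem lintegral_radialMeasure {f : ℝ → ENNReal} (hf : Measurable f) :
    ∫⁻ x, f x ∂radialMeasure = ∫⁻ x in Set.Ioc 0 1, ENNReal.ofReal (2 * x) * f x := by
  rw [radialMeasure, lintegral_withDensity_eq_lintegral_mul _ (by fun_prop) hf]
  rfl

instance : IsProbabilityMeasure radialMeasure := by
  constructor
  have h := lintegral_radialMeasure (f := fun _ => 1) measurable_const
  simp only [lintegral_const, one_mul, mul_one] at h
  rw [h, ← ofReal_integral_eq_lintegral_ofReal]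
  · rw [← intervalIntegral.integral_of_le zero_le_one]
    rw [intervalIntegral.integral_const_mul, integral_id]
    norm_num
  · change IntegrableOn (fun x : ℝ => 2 * x) _
    rw [← intervalIntegrable_iff_integrableOn_Ioc_of_le zero_le_one]
    exact (by fun_prop : Continuous fun x : ℝ => 2 * x).intervalIntegrable _ _
  · filter_upwards [ae_restrict_mem measurableSet_Ioc] with x hx
    simp; linarith [hx.1]

instance : IsProbabilityMeasure (volume.restrict (Set.Ico (0 : ℝ) 1)) := ⟨by simp⟩

instance : IsProbabilityMeasure cellMeasure := by
  unfold cellMeasure; infer_instance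

/-- The limit law as a probability measure on the parameter space. -/
def limitProb : ProbabilityMeasure ParamSpace :=
  ⟨cellMeasure.map limitMap, Measure.isProbabilityMeasure_map continuous_limitMap.aemeasurable⟩

theorem integral_fourier_Ico (m : ℤ) :
    ∫ u in Set.Ico (0 : ℝ) 1, (fourier m (u : UnitAddCircle) : ℂ) = if m = 0 then 1 else 0 := by
  rw [integral_Ico_eq_integral_Ioc, ← intervalIntegral.integral_of_le zero_le_one]
  split_ifs with h
  · simp [h]
  · have hc : 2 * (Real.pi : ℂ) * Complex.I * m ≠ 0 := by
      simp [Real.pi_ne_zero, Complex.I_ne_zero, h]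
    simp_rw [fourier_coe_apply]
    have := integral_exp_mul_complex (a := 0) (b := 1) hc
    simp only [Complex.ofReal_one, div_one]
    rw [this]
    have : Complex.exp (2 * Real.pi * Complex.I * m * (1 : ℝ)) = 1 := by
      rw [Complex.exp_eq_one_iff]; exact ⟨m, by push_cast; ring⟩
    rw [this]
    simp

theorem integral_radialMeasure_pow (k : ℕ) :
    ∫ x, (((Set.projIcc 0 1 zero_le_one x : unitInterval) : ℝ) : ℂ) ^ k ∂radialMeasure =
      2 / ((k : ℂ) + 2) := by
  rw [integral_radialMeasure]
  have : ∀ x ∈ Set.uIcc (0 : ℝ) 1,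
      (2 * x : ℝ) • (((Set.projIcc 0 1 zero_le_one x : unitInterval) : ℝ) : ℂ) ^ k =
        ((2 * x ^ (k + 1) : ℝ) : ℂ) := by
    intro x hx
    rw [Set.uIcc_of_le zero_le_one] at hx
    rw [Set.projIcc_of_mem _ hx]
    simp
    ring
  rw [intervalIntegral.integral_congr this, intervalIntegral.integral_ofReal]
  simp
  ring

theorem integral_paramMonomial_limitProb (p : (ℕ × ℕ) × (ℤ × ℤ)) :
    ∫ z, paramMonomial p z ∂(limitProb : Measure ParamSpace) = monomialLimit p := by
  obtain ⟨⟨l, k⟩, ⟨m, n⟩⟩ := p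
  change ∫ z, paramMonomial _ z ∂(cellMeasure.map limitMap) = _
  rw [integral_map continuous_limitMap.aemeasurable
    (BoundedContinuousFunction.continuous _).aestronglyMeasurable]
  have h (w : ℝ × (ℝ × ℝ)) : paramMonomial ((l, k), (m, n)) (limitMap w) = (0 : ℂ) ^ l *
      ((fun x : ℝ => (((Set.projIcc 0 1 zero_le_one x : unitInterval) : ℝ) : ℂ) ^ k) w.1 *
      (fun y : ℝ × ℝ => (fourier m (y.1 : UnitAddCircle) * fourier n (y.2 : UnitAddCircle) : ℂ))
        w.2) := by
    simp [paramMonomial_apply, limitMap, mul_assoc]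
  rw [integral_congr_ae (.of_forall h), integral_const_mul, cellMeasure,
    integral_prod_mul
      (fun x : ℝ => (((Set.projIcc 0 1 zero_le_one x : unitInterval) : ℝ) : ℂ) ^ k)
      (fun y : ℝ × ℝ => (fourier m (y.1 : UnitAddCircle) * fourier n (y.2 : UnitAddCircle) : ℂ)),
    integral_radialMeasure_pow,
    integral_prod_mul (fun u : ℝ => (fourier m (u : UnitAddCircle) : ℂ))
      (fun u : ℝ => (fourier n (u : UnitAddCircle) : ℂ)), integral_fourier_Ico,
    integral_fourier_Ico]
  rcases Nat.eq_zero_or_pos l with rfl | hl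
  · by_cases hm : m = 0 <;> by_cases hn : n = 0 <;> simp [monomialLimit, hm, hn]
  · simp [monomialLimit, hl.ne']

/-- The star subalgebra spanned by monomials. -/
def monomialAlgebra : StarSubalgebra ℂ (BoundedContinuousFunction ParamSpace ℂ) :=
  StarAlgebra.adjoin ℂ (Set.range paramMonomial)

theorem paramMonomial_add (p q : (ℕ × ℕ) × (ℤ × ℤ)) :
    paramMonomial (p + q) = paramMonomial p * paramMonomial q := by
  ext z
  rw [BoundedContinuousFunction.mul_apply, paramMonomial_apply, paramMonomial_apply,
    paramMonomial_apply]
  simp only [Prod.fst_add, Prod.snd_add, fourier_add, pow_add]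
  ring

theorem paramMonomial_zero : paramMonomial 0 = 1 := by
  ext z
  simp [paramMonomial_apply]

theorem star_paramMonomial (p : (ℕ × ℕ) × (ℤ × ℤ)) :
    star (paramMonomial p) = paramMonomial (p.1, -p.2) := by
  ext z
  rw [BoundedContinuousFunction.star_apply, paramMonomial_apply, paramMonomial_apply]
  simp

theorem mem_span_of_mem_monomialAlgebra {g : BoundedContinuousFunction ParamSpace ℂ}
    (hg : g ∈ monomialAlgebra) : g ∈ Submodule.span ℂ (Set.range paramMonomial) := by
  have hstar : Set.range paramMonomial ∪ star (Set.range paramMonomial) =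
      Set.range paramMonomial := by
    refine Set.union_eq_self_of_subset_right fun g hg => ?_
    obtain ⟨p, hp⟩ := Set.mem_star.1 hg
    exact ⟨(p.1, -p.2), by rw [← star_paramMonomial, hp, star_star]⟩
  let M : Submonoid (BoundedContinuousFunction ParamSpace ℂ) :=
    { carrier := Set.range paramMonomial
      mul_mem' := by
        rintro _ _ ⟨p, rfl⟩ ⟨q, rfl⟩
        exact ⟨p + q, paramMonomial_add p q⟩
      one_mem' := ⟨0, paramMonomial_zero⟩ }
  have h1 : g ∈ Algebra.adjoin ℂ (Set.range paramMonomial) := by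
    rw [← hstar, ← StarAlgebra.adjoin_toSubalgebra]
    exact hg
  rw [← Subalgebra.mem_toSubmodule, Algebra.adjoin_eq_span] at h1
  rwa [show Submonoid.closure (Set.range paramMonomial) = M from Submonoid.closure_eq M] at h1

theorem separatesPoints_monomialAlgebra :
    (monomialAlgebra.map (BoundedContinuousFunction.toContinuousMapStarₐ ℂ)).SeparatesPoints := by
  intro z w hzw
  by_contra! hcon
  have h (p : (ℕ × ℕ) × (ℤ × ℤ)) : paramMonomial p z = paramMonomial p w :=
    hcon _ ⟨_, ⟨paramMonomial p, StarAlgebra.subset_adjoin ℂ _ ⟨p, rfl⟩, rfl⟩, rfl⟩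
  refine hzw ?_
  have h1 := h ((1, 0), (0, 0))
  have h2 := h ((0, 1), (0, 0))
  have h3 := h ((0, 0), (1, 0))
  have h4 := h ((0, 0), (0, 1))
  simp only [paramMonomial_apply, pow_one, pow_zero, fourier_zero, mul_one, one_mul,
    Complex.ofReal_inj, fourier_one, Circle.coe_inj] at h1 h2 h3 h4
  exact Prod.ext (Prod.ext (Subtype.ext h1) (Subtype.ext h2))
    (Prod.ext (AddCircle.injective_toCircle one_ne_zero h3)
      (AddCircle.injective_toCircle one_ne_zero h4))

theorem tendsto_sampleProb : Tendsto sampleProb atTop (𝓝 limitProb) := by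
  refine ProbabilityMeasure.tendsto_of_tight_of_separatesPoints ℂ
    IsTightMeasureSet.of_compactSpace separatesPoints_monomialAlgebra fun g hg => ?_
  replace hg := mem_span_of_mem_monomialAlgebra hg
  induction hg using Submodule.span_induction with
  | mem g hg =>
    obtain ⟨p, rfl⟩ := hg
    rw [integral_paramMonomial_limitProb]
    refine (tendsto_integral_paramMonomial p).congr' ?_
    filter_upwards [eventually_ge_atTop 1] with T hT
    change _ = ∫ z, _ ∂(sampleMeasure (max T 1))
    rw [max_eq_left hT]
  | zero => simp
  | add f g _ _ hf hg =>
    have hadd (μ : ProbabilityMeasure ParamSpace) : ∫ z, (f + g) z ∂(μ : Measure ParamSpace) =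
        ∫ z, f z ∂(μ : Measure ParamSpace) + ∫ z, g z ∂(μ : Measure ParamSpace) :=
      integral_add (f.integrable _) (g.integrable _)
    simp_rw [hadd]
    exact (hf).add (hg)
  | smul c f _ hf =>
    have hsmul (μ : ProbabilityMeasure ParamSpace) : ∫ z, (c • f) z ∂(μ : Measure ParamSpace) =
        c • ∫ z, f z ∂(μ : Measure ParamSpace) := integral_smul c _
    simp_rw [hsmul]
    exact (hf).const_smul c

/-- `‖γ‖² / T²` in terms of `s = 1/T`, `x = a/T`, `y = b/a`, `t = c/a`. -/
def normForm (s x y t : ℝ) : ℝ :=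
  x ^ 2 * (1 + y ^ 2) * (1 + t ^ 2) + 2 * s ^ 2 * y * t + s ^ 4 / x ^ 2

/-- `Tr γ / T` in terms of `s = 1/T`, `x = a/T`, `y = b/a`, `t = c/a`. -/
def trForm (s x y t : ℝ) : ℝ := x * (1 + y * t) + s ^ 2 / x

theorem normForm_zero (x y t : ℝ) : normForm 0 x y t = x ^ 2 * (1 + y ^ 2) * (1 + t ^ 2) := by
  simp [normForm]

theorem trForm_zero (x y t : ℝ) : trForm 0 x y t = x * (1 + y * t) := by
  simp [trForm]

/-- The counting condition in the coordinates `s = 1/T`, `x = a/T`, `y = b/a`, `t = c/a`. -/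
def InRegion (α β s x y t : ℝ) : Prop :=
  0 < x ∧ normForm s x y t ≤ 1 ∧ α < trForm s x y t ∧ trForm s x y t < β

theorem measurableSet_inRegion {Ω : Type*} [MeasurableSpace Ω] (α β : ℝ) {s x y t : Ω → ℝ}
    (hs : Measurable s) (hx : Measurable x) (hy : Measurable y) (ht : Measurable t) :
    MeasurableSet {ω | InRegion α β (s ω) (x ω) (y ω) (t ω)} := by
  have hn : Measurable fun ω => normForm (s ω) (x ω) (y ω) (t ω) := by unfold normForm; fun_prop
  have htr : Measurable fun ω => trForm (s ω) (x ω) (y ω) (t ω) := by unfold trForm; fun_prop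
  exact (measurableSet_lt measurable_const hx).inter ((measurableSet_le hn measurable_const).inter
    ((measurableSet_lt measurable_const htr).inter (measurableSet_lt htr measurable_const)))

/-- The representative in `[0, 1)` of a point of the circle. -/
def circleRep (u : UnitAddCircle) : ℝ := AddCircle.equivIco 1 0 u

theorem circleRep_coe {u : ℝ} (hu : u ∈ Set.Ico (0 : ℝ) 1) : circleRep (u : UnitAddCircle) = u := by
  rw [circleRep, AddCircle.equivIco_coe_eq (by simpa using hu)]

theorem measurable_circleRep : Measurable circleRep :=
  measurable_subtype_coe.comp (AddCircle.measurableEquivIco 1 0).measurable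

theorem continuousAt_circleRep {u : UnitAddCircle} (hu : u ≠ 0) : ContinuousAt circleRep u :=
  continuous_subtype_val.continuousAt.comp (AddCircle.continuousAt_equivIco 1 0 (by simpa using hu))

/-- The counting condition for `b/a ∈ [i, i+1)` and `c/a ∈ [j, j+1)`, as a subset of the
parameter space. -/
def cellSet (α β : ℝ) (p : ℤ × ℤ) : Set ParamSpace :=
  {z | InRegion α β z.1.1 z.1.2 (p.1 + circleRep z.2.1) (p.2 + circleRep z.2.2)}

theorem measurableSet_cellSet (α β : ℝ) (p : ℤ × ℤ) : MeasurableSet (cellSet α β p) := by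
  have := measurable_circleRep
  exact measurableSet_inRegion α β (by fun_prop) (by fun_prop) (by fun_prop) (by fun_prop)

theorem frontier_cellSet {α β : ℝ} {p : ℤ × ℤ} {z : ParamSpace} (hz : z ∈ frontier (cellSet α β p))
    (hx : (z.1.2 : ℝ) ≠ 0) (hu : z.2.1 ≠ 0) (hv : z.2.2 ≠ 0) :
    normForm z.1.1 z.1.2 (p.1 + circleRep z.2.1) (p.2 + circleRep z.2.2) = 1 ∨
    trForm z.1.1 z.1.2 (p.1 + circleRep z.2.1) (p.2 + circleRep z.2.2) = α ∨
    trForm z.1.1 z.1.2 (p.1 + circleRep z.2.1) (p.2 + circleRep z.2.2) = β := by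
  by_contra! h
  obtain ⟨h1, h2, h3⟩ := h
  rw [frontier_eq_closure_inter_closure] at hz
  obtain ⟨hz1, hz2⟩ := hz
  rw [mem_closure_iff_frequently] at hz1 hz2
  have hx0 : 0 < (z.1.2 : ℝ) := lt_of_le_of_ne z.1.2.2.1 hx.symm
  have cs : ContinuousAt (fun z : ParamSpace => (z.1.1 : ℝ)) z := by fun_prop
  have cx : ContinuousAt (fun z : ParamSpace => (z.1.2 : ℝ)) z := by fun_prop
  have cy : ContinuousAt (fun z : ParamSpace => p.1 + circleRep z.2.1) z :=
    continuousAt_const.add ((continuousAt_circleRep hu).comp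
      (f := fun z : ParamSpace => z.2.1) (by fun_prop))
  have ct : ContinuousAt (fun z : ParamSpace => p.2 + circleRep z.2.2) z :=
    continuousAt_const.add ((continuousAt_circleRep hv).comp
      (f := fun z : ParamSpace => z.2.2) (by fun_prop))
  have cn : ContinuousAt (fun z : ParamSpace => normForm z.1.1 z.1.2 (p.1 + circleRep z.2.1)
      (p.2 + circleRep z.2.2)) z := by
    unfold normForm
    exact ((((cx.pow 2).mul (continuousAt_const.add (cy.pow 2))).mul
      (continuousAt_const.add (ct.pow 2))).add
      (((continuousAt_const.mul (cs.pow 2)).mul cy).mul ct)).add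
      ((cs.pow 4).div (cx.pow 2) (pow_ne_zero 2 hx))
  have ctr : ContinuousAt (fun z : ParamSpace => trForm z.1.1 z.1.2 (p.1 + circleRep z.2.1)
      (p.2 + circleRep z.2.2)) z := by
    unfold trForm
    exact (cx.mul (continuousAt_const.add (cy.mul ct))).add ((cs.pow 2).div cx hx)
  rcases lt_or_gt_of_ne h1 with h1 | h1
  · rcases lt_or_gt_of_ne h2 with h2 | h2
    · refine hz1 ?_
      filter_upwards [ctr.eventually_lt_const h2] with w hw hmem
      exact absurd hmem.2.2.1 (not_lt.2 hw.le)
    rcases lt_or_gt_of_ne h3 with h3 | h3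
    · refine hz2 ?_
      filter_upwards [cn.eventually_lt_const h1, ctr.eventually_const_lt h2,
        ctr.eventually_lt_const h3, cx.eventually_const_lt hx0] with w k1 k2 k3 k4 hmem
      exact hmem ⟨k4, k1.le, k2, k3⟩
    · refine hz1 ?_
      filter_upwards [ctr.eventually_const_lt h3] with w hw hmem
      exact absurd hmem.2.2.2 (not_lt.2 hw.le)
  · refine hz1 ?_
    filter_upwards [cn.eventually_const_lt h1] with w hw hmem
    exact absurd hmem.2.1 (not_le.2 hw)

theorem ae_radialMeasure : ∀ᵐ x ∂radialMeasure, x ∈ Set.Ioc (0 : ℝ) 1 :=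
  (withDensity_absolutelyContinuous _ _).ae_le (ae_restrict_mem measurableSet_Ioc)

theorem ae_cellMeasure : ∀ᵐ w ∂cellMeasure, w.1 ∈ Set.Ioc (0 : ℝ) 1 ∧
    w.2.1 ∈ Set.Ioo (0 : ℝ) 1 ∧ w.2.2 ∈ Set.Ioo (0 : ℝ) 1 := by
  have h : ∀ᵐ u ∂(volume.restrict (Set.Ico (0 : ℝ) 1)), u ∈ Set.Ioo (0 : ℝ) 1 := by
    filter_upwards [ae_restrict_mem measurableSet_Ico,
      (Set.countable_singleton (0 : ℝ)).ae_notMem _] with u h1 h2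
    exact ⟨lt_of_le_of_ne h1.1 (Ne.symm h2), h1.2⟩
  unfold cellMeasure
  have h2 := Measure.quasiMeasurePreserving_snd (μ := radialMeasure) (ν :=
    (volume.restrict (Set.Ico (0 : ℝ) 1)).prod (volume.restrict (Set.Ico (0 : ℝ) 1)))
  have h3 := Measure.quasiMeasurePreserving_fst (μ := volume.restrict (Set.Ico (0 : ℝ) 1))
    (ν := volume.restrict (Set.Ico (0 : ℝ) 1))
  have h4 := Measure.quasiMeasurePreserving_snd (μ := volume.restrict (Set.Ico (0 : ℝ) 1))
    (ν := volume.restrict (Set.Ico (0 : ℝ) 1))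
  exact (Measure.quasiMeasurePreserving_fst.ae ae_radialMeasure).and
    ((h2.ae (h3.ae h)).and (h2.ae (h4.ae h)))

theorem ae_cellMeasure_ne (p : ℤ × ℤ) (c : ℝ) : ∀ᵐ w ∂cellMeasure,
    normForm 0 w.1 (p.1 + w.2.1) (p.2 + w.2.2) ≠ 1 ∧
      trForm 0 w.1 (p.1 + w.2.1) (p.2 + w.2.2) ≠ c := by
  unfold cellMeasure
  have hm : Measurable fun w : ℝ × (ℝ × ℝ) => normForm 0 w.1 (p.1 + w.2.1) (p.2 + w.2.2) := by
    unfold normForm; fun_prop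
  have hm' : Measurable fun w : ℝ × (ℝ × ℝ) => trForm 0 w.1 (p.1 + w.2.1) (p.2 + w.2.2) := by
    unfold trForm; fun_prop
  have hms : MeasurableSet {w : ℝ × (ℝ × ℝ) | normForm 0 w.1 (p.1 + w.2.1) (p.2 + w.2.2) ≠ 1 ∧
      trForm 0 w.1 (p.1 + w.2.1) (p.2 + w.2.2) ≠ c} :=
    (hm (measurableSet_singleton _).compl).inter (hm' (measurableSet_singleton _).compl)
  rw [Measure.ae_prod_iff_ae_ae hms]
  filter_upwards [ae_radialMeasure] with x hx
  refine (Measure.ae_prod_iff_ae_ae (measurable_prodMk_left hms)).2 ?_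
  filter_upwards [(Set.countable_singleton (-(p.1 : ℝ))).ae_notMem _] with u hu
  have hy : (p.1 : ℝ) + u ≠ 0 := fun h => hu (by simp; linarith)
  have hx0 : x ≠ 0 := hx.1.ne'
  set y : ℝ := p.1 + u
  let r : ℝ := 1 / (x ^ 2 * (1 + y ^ 2)) - 1
  filter_upwards [(Set.countable_singleton ((c / x - 1) / y - p.2)).ae_notMem _,
    (Set.countable_singleton (Real.sqrt r - p.2)).ae_notMem _,
    (Set.countable_singleton (-Real.sqrt r - p.2)).ae_notMem _] with v h1 h2 h3
  simp only [Set.mem_singleton_iff] at h1 h2 h3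
  refine ⟨fun h => ?_, fun h => ?_⟩
  · have hr : (p.2 + v) ^ 2 = r := by
      rw [normForm_zero] at h
      simp only [r]
      field_simp
      linarith
    have : (p.2 + v : ℝ) = Real.sqrt r ∨ (p.2 + v : ℝ) = -Real.sqrt r := by
      rw [← hr, Real.sqrt_sq_eq_abs]
      rcases abs_choice ((p.2 : ℝ) + v) with h | h <;> rw [h] <;> simp
    rcases this with h | h
    · exact h2 (by linarith)
    · exact h3 (by linarith)
  · refine h1 ?_
    rw [trForm_zero] at h
    field_simp
    linarith

theorem limitProb_frontier_cellSet (α β : ℝ) (p : ℤ × ℤ) :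
    limitProb (frontier (cellSet α β p)) = 0 := by
  rw [ProbabilityMeasure.null_iff_toMeasure_null]
  change cellMeasure.map limitMap _ = 0
  rw [Measure.map_apply continuous_limitMap.measurable isClosed_frontier.measurableSet]
  have : ∀ᵐ w ∂cellMeasure, w ∉ limitMap ⁻¹' frontier (cellSet α β p) := by
    filter_upwards [ae_cellMeasure, ae_cellMeasure_ne p α, ae_cellMeasure_ne p β] with w hw hα hβ hmem
    obtain ⟨hx, hu, hv⟩ := hw
    have h := frontier_cellSet hmem
    have e1 : circleRep (limitMap w).2.1 = w.2.1 := circleRep_coe ⟨hu.1.le, hu.2⟩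
    have e2 : circleRep (limitMap w).2.2 = w.2.2 := circleRep_coe ⟨hv.1.le, hv.2⟩
    have e3 : ((limitMap w).1.2 : ℝ) = w.1 := by
      simp only [limitMap]; rw [Set.projIcc_of_mem _ ⟨hx.1.le, hx.2⟩]
    have e4 : ((limitMap w).1.1 : ℝ) = 0 := rfl
    rw [e1, e2, e3, e4] at h
    have hne (u : UnitAddCircle) (hu : 0 < circleRep u) : u ≠ 0 := by
      rintro rfl
      have : circleRep ((0 : ℝ) : UnitAddCircle) = 0 := circleRep_coe ⟨le_rfl, one_pos⟩
      rw [AddCircle.coe_zero] at this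
      exact hu.ne' this
    rcases h hx.1.ne' (hne _ (e1 ▸ hu.1)) (hne _ (e2 ▸ hv.1)) with h | h | h
    · exact hα.1 h
    · exact hα.2 h
    · exact hβ.2 h
  exact measure_eq_zero_iff_ae_notMem.2 this

theorem limitProb_cellSet (α β : ℝ) (p : ℤ × ℤ) :
    (limitProb : Measure ParamSpace).real (cellSet α β p) =
      cellMeasure.real {w | InRegion α β 0 w.1 (p.1 + w.2.1) (p.2 + w.2.2)} := by
  change (cellMeasure.map limitMap).real _ = _
  rw [map_measureReal_apply continuous_limitMap.measurable (measurableSet_cellSet α β p)]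
  refine measureReal_congr ?_
  filter_upwards [ae_cellMeasure] with w hw
  obtain ⟨hx, hu, hv⟩ := hw
  have e1 : circleRep (limitMap w).2.1 = w.2.1 := circleRep_coe ⟨hu.1.le, hu.2⟩
  have e2 : circleRep (limitMap w).2.2 = w.2.2 := circleRep_coe ⟨hv.1.le, hv.2⟩
  have e3 : ((limitMap w).1.2 : ℝ) = w.1 := by
    simp only [limitMap]; rw [Set.projIcc_of_mem _ ⟨hx.1.le, hx.2⟩]
  have e4 : ((limitMap w).1.1 : ℝ) = 0 := rfl
  change InRegion _ _ _ _ _ _ = InRegion _ _ _ _ _ _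
  rw [e1, e2, e3, e4]

open Classical in
theorem tendsto_card_cell (α β : ℝ) (p : ℤ × ℤ) :
    Tendsto (fun T : ℝ => (((unitIndex T).filter fun i => paramPoint T i ∈ cellSet α β p).card : ℝ) /
      (unitIndex T).card) atTop
      (𝓝 (cellMeasure.real {w | InRegion α β 0 w.1 (p.1 + w.2.1) (p.2 + w.2.2)})) := by
  have h := ProbabilityMeasure.tendsto_measure_of_null_frontier_of_tendsto tendsto_sampleProb
    (limitProb_frontier_cellSet α β p)
  rw [← limitProb_cellSet]
  refine ((NNReal.continuous_coe.tendsto _).comp h).congr' ?_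
  filter_upwards [eventually_ge_atTop 1] with T hT
  rw [← sampleMeasure_real T (measurableSet_cellSet α β p)]
  change (sampleMeasure (max T 1)).real _ = _
  rw [max_eq_left hT]

/-- The upper right entry of the matrix with parameters `p` and `i`. -/
def upperEntry (p : ℤ × ℤ) (i : Σ n : ℕ, (ZMod (n + 1))ˣ) : ℤ :=
  (i.2 : ZMod (i.1 + 1)).val + p.1 * (i.1 + 1)

/-- The lower left entry of the matrix with parameters `p` and `i`. -/
def lowerEntry (p : ℤ × ℤ) (i : Σ n : ℕ, (ZMod (n + 1))ˣ) : ℤ :=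
  (-((i.2⁻¹ : (ZMod (i.1 + 1))ˣ) : ZMod (i.1 + 1))).val + p.2 * (i.1 + 1)

theorem upperEntry_cast (p : ℤ × ℤ) (i : Σ n : ℕ, (ZMod (n + 1))ˣ) :
    (upperEntry p i : ZMod (i.1 + 1)) = i.2 := by
  have : ((i.1 : ZMod (i.1 + 1)) + 1) = 0 := by exact_mod_cast ZMod.natCast_self (i.1 + 1)
  simp [upperEntry, this]

theorem lowerEntry_cast (p : ℤ × ℤ) (i : Σ n : ℕ, (ZMod (n + 1))ˣ) :
    (lowerEntry p i : ZMod (i.1 + 1)) = -((i.2⁻¹ : (ZMod (i.1 + 1))ˣ) : ZMod (i.1 + 1)) := by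
  have : ((i.1 : ZMod (i.1 + 1)) + 1) = 0 := by exact_mod_cast ZMod.natCast_self (i.1 + 1)
  simp [lowerEntry, this]

theorem dvd_one_add_upperEntry_mul_lowerEntry (p : ℤ × ℤ) (i : Σ n : ℕ, (ZMod (n + 1))ˣ) :
    ((i.1 + 1 : ℕ) : ℤ) ∣ 1 + upperEntry p i * lowerEntry p i := by
  rw [← ZMod.intCast_zmod_eq_zero_iff_dvd]
  push_cast
  rw [upperEntry_cast, lowerEntry_cast]
  simp

/-- The matrix in `SL(2,ℤ)` with upper left entry `n + 1`, whose off-diagonal entries lie in the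
given residue classes and in the cell `p`. -/
def cellMatrix (w : (ℤ × ℤ) × (Σ n : ℕ, (ZMod (n + 1))ˣ)) : SL2Z :=
  ⟨!![((w.2.1 + 1 : ℕ) : ℤ), upperEntry w.1 w.2; lowerEntry w.1 w.2,
    (1 + upperEntry w.1 w.2 * lowerEntry w.1 w.2) / ((w.2.1 + 1 : ℕ) : ℤ)], by
    rw [Matrix.det_fin_two_of, Int.mul_ediv_cancel' (dvd_one_add_upperEntry_mul_lowerEntry _ _)]
    ring⟩

theorem cellMatrix_injective : Function.Injective cellMatrix := by
  rintro ⟨⟨p, r⟩, ⟨n, u⟩⟩ ⟨⟨p', r'⟩, ⟨n', u'⟩⟩ h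
  have h00 : ((n + 1 : ℕ) : ℤ) = ((n' + 1 : ℕ) : ℤ) := congrArg (fun γ : SL2Z => γ 0 0) h
  have h01 : upperEntry (p, r) ⟨n, u⟩ = upperEntry (p', r') ⟨n', u'⟩ :=
    congrArg (fun γ : SL2Z => γ 0 1) h
  have h10 : lowerEntry (p, r) ⟨n, u⟩ = lowerEntry (p', r') ⟨n', u'⟩ :=
    congrArg (fun γ : SL2Z => γ 1 0) h
  obtain rfl : n = n' := by omega
  have hu : u = u' := by
    have e1 := upperEntry_cast (p, r) ⟨n, u⟩
    have e2 := upperEntry_cast (p', r') ⟨n, u'⟩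
    rw [h01] at e1
    exact Units.ext (e1.symm.trans e2)
  subst hu
  have hn : ((n : ℤ) + 1) ≠ 0 := by omega
  simp only [upperEntry, lowerEntry, add_right_inj] at h01 h10
  rw [mul_right_cancel₀ hn h01, mul_right_cancel₀ hn h10]

theorem range_cellMatrix : Set.range cellMatrix = {γ : SL2Z | 0 < γ 0 0} := by
  ext γ
  constructor
  · rintro ⟨w, rfl⟩
    change (0 : ℤ) < ((w.2.1 + 1 : ℕ) : ℤ)
    omega
  · intro h
    change 0 < γ 0 0 at h
    obtain ⟨n, hn⟩ : ∃ n : ℕ, γ 0 0 = ((n + 1 : ℕ) : ℤ) := ⟨(γ 0 0 - 1).toNat, by omega⟩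
    have hdet : γ 0 0 * γ 1 1 - γ 0 1 * γ 1 0 = 1 := by
      rw [← Matrix.det_fin_two, γ.det_coe]
    have hz : ((γ 0 1 : ℤ) : ZMod (n + 1)) * (-((γ 1 0 : ℤ) : ZMod (n + 1))) = 1 := by
      have := congrArg (fun z : ℤ => (z : ZMod (n + 1))) hdet
      simp only [hn, Int.cast_sub, Int.cast_mul, Int.cast_natCast, ZMod.natCast_self, zero_mul,
        Int.cast_one, zero_sub] at this
      rw [mul_neg, this]
    let u : (ZMod (n + 1))ˣ := ⟨_, _, hz, by rw [mul_comm]; exact hz⟩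
    have hval (z : ℤ) : ((((z : ℤ) : ZMod (n + 1)).val : ℕ) : ℤ) + z / (n + 1) * (n + 1) = z := by
      rw [ZMod.val_intCast]
      push_cast
      rw [mul_comm]
      exact Int.emod_add_mul_ediv _ _
    have h01 : upperEntry (γ 0 1 / (n + 1), γ 1 0 / (n + 1)) ⟨n, u⟩ = γ 0 1 := hval _
    have h10 : lowerEntry (γ 0 1 / (n + 1), γ 1 0 / (n + 1)) ⟨n, u⟩ = γ 1 0 := by
      simp only [lowerEntry]
      have : -((u⁻¹ : (ZMod (n + 1))ˣ) : ZMod (n + 1)) = ((γ 1 0 : ℤ) : ZMod (n + 1)) := by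
        change -(-((γ 1 0 : ℤ) : ZMod (n + 1))) = _
        rw [neg_neg]
      rw [this]
      exact hval _
    refine ⟨((γ 0 1 / (n + 1), γ 1 0 / (n + 1)), ⟨n, u⟩), ?_⟩
    have h11 : (1 + γ 0 1 * γ 1 0) / ((n + 1 : ℕ) : ℤ) = γ 1 1 := by
      rw [← hn]
      exact Int.ediv_eq_of_eq_mul_right h.ne' (by linarith)
    ext i j
    change (!![((n + 1 : ℕ) : ℤ), upperEntry _ _; lowerEntry _ _, (1 + upperEntry _ _ * lowerEntry _ _) / _] :
      Matrix (Fin 2) (Fin 2) ℤ) i j = _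
    rw [h01, h10, h11, ← hn]
    fin_cases i <;> fin_cases j <;> rfl

theorem frobNorm_le_iff (γ : SL2Z) {T : ℝ} (hT : 0 ≤ T) :
    frobNorm γ ≤ T ↔
      ((γ 0 0 : ℝ) ^ 2 + (γ 0 1 : ℝ) ^ 2 + (γ 1 0 : ℝ) ^ 2 + (γ 1 1 : ℝ) ^ 2) ≤ T ^ 2 := by
  rw [frobNorm, Real.sqrt_le_left hT]
  push_cast
  rfl

theorem cellMatrix_mem_iff {T : ℝ} (hT : 1 ≤ T) (α β : ℝ) (p : ℤ × ℤ)
    (i : Σ n : ℕ, (ZMod (n + 1))ˣ) :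
    (frobNorm (cellMatrix (p, i)) ≤ T ∧ α < (trZ (cellMatrix (p, i)) : ℝ) / T ∧
      (trZ (cellMatrix (p, i)) : ℝ) / T < β) ↔
      (i ∈ unitIndex T ∧ paramPoint T i ∈ cellSet α β p) := by
  obtain ⟨n, u⟩ := i
  have hT0 : 0 < T := by linarith
  set γ := cellMatrix (p, ⟨n, u⟩)
  have h00 : γ 0 0 = ((n + 1 : ℕ) : ℤ) := rfl
  have h01 : γ 0 1 = upperEntry p ⟨n, u⟩ := rfl
  have h10 : γ 1 0 = lowerEntry p ⟨n, u⟩ := rfl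
  have hdet : γ 0 0 * γ 1 1 - γ 0 1 * γ 1 0 = 1 := by
    rw [← Matrix.det_fin_two, γ.det_coe]
  have hdetR : (γ 0 0 : ℝ) * γ 1 1 - γ 0 1 * γ 1 0 = 1 := by exact_mod_cast hdet
  have ha : (γ 0 0 : ℝ) = ((n + 1 : ℕ) : ℝ) := by rw [h00]; rfl
  have ha0 : (0 : ℝ) < γ 0 0 := by rw [ha]; positivity
  have hrep (z : ZMod (n + 1)) : circleRep (ZMod.toAddCircle z) = z.val / ((n + 1 : ℕ) : ℝ) := by
    rw [ZMod.toAddCircle_apply, circleRep_coe]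
    refine ⟨by positivity, ?_⟩
    rw [div_lt_one (by positivity)]
    exact_mod_cast ZMod.val_lt z
  have hy : (p.1 : ℝ) + circleRep (paramPoint T ⟨n, u⟩).2.1 = (γ 0 1 : ℝ) / γ 0 0 := by
    rw [ha, h01]
    simp only [paramPoint, hrep, upperEntry]
    push_cast
    field_simp
    ring
  have ht : (p.2 : ℝ) + circleRep (paramPoint T ⟨n, u⟩).2.2 = (γ 1 0 : ℝ) / γ 0 0 := by
    rw [ha, h10]
    simp only [paramPoint, hrep, lowerEntry]
    push_cast
    field_simp
    ring
  have hmem : (⟨n, u⟩ : Σ n : ℕ, (ZMod (n + 1))ˣ) ∈ unitIndex T ↔ (γ 0 0 : ℝ) ≤ T := by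
    rw [unitIndex, Finset.mem_sigma, ha, ← Nat.le_floor_iff hT0.le]
    simp only [Finset.mem_range, Finset.mem_univ, and_true, Nat.lt_iff_add_one_le]
  have hs : ((paramPoint T ⟨n, u⟩).1.1 : ℝ) = 1 / T := by
    simp only [paramPoint]
    rw [Set.projIcc_of_mem zero_le_one (show 1 / T ∈ Set.Icc (0 : ℝ) 1 from
      ⟨by positivity, by rw [div_le_one hT0]; exact hT⟩)]
  have hx (h : (γ 0 0 : ℝ) ≤ T) : ((paramPoint T ⟨n, u⟩).1.2 : ℝ) = γ 0 0 / T := by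
    simp only [paramPoint]
    rw [← ha, Set.projIcc_of_mem zero_le_one (show (γ 0 0 : ℝ) / T ∈ Set.Icc (0 : ℝ) 1 from
      ⟨by positivity, by rw [div_le_one hT0]; exact h⟩)]
  have hd : (γ 1 1 : ℝ) = (1 + γ 0 1 * γ 1 0) / γ 0 0 := by
    rw [eq_div_iff ha0.ne']; linarith
  have hnorm : normForm (1 / T) (γ 0 0 / T) (γ 0 1 / γ 0 0) (γ 1 0 / γ 0 0) =
      ((γ 0 0 : ℝ) ^ 2 + (γ 0 1 : ℝ) ^ 2 + (γ 1 0 : ℝ) ^ 2 + (γ 1 1 : ℝ) ^ 2) / T ^ 2 := by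
    rw [hd, normForm]
    field_simp
    ring
  have htr : trForm (1 / T) (γ 0 0 / T) (γ 0 1 / γ 0 0) (γ 1 0 / γ 0 0) = (trZ γ : ℝ) / T := by
    rw [trZ, Int.cast_add, hd, trForm]
    field_simp
    ring
  rw [hmem, frobNorm_le_iff γ hT0.le]
  constructor
  · rintro ⟨h1, h2, h3⟩
    have hle : (γ 0 0 : ℝ) ≤ T := by
      refine abs_le_of_sq_le_sq' ?_ hT0.le |>.2
      nlinarith [sq_nonneg (γ 0 1 : ℝ), sq_nonneg (γ 1 0 : ℝ), sq_nonneg (γ 1 1 : ℝ)]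
    refine ⟨hle, ?_⟩
    change InRegion _ _ _ _ _ _
    rw [hs, hx hle, hy, ht]
    refine ⟨by positivity, ?_, ?_, ?_⟩
    · rw [hnorm, div_le_one (by positivity)]; exact h1
    · rwa [htr]
    · rwa [htr]
  · rintro ⟨hle, h⟩
    change InRegion _ _ _ _ _ _ at h
    rw [hs, hx hle, hy, ht] at h
    obtain ⟨-, h1, h2, h3⟩ := h
    rw [hnorm, div_le_one (by positivity)] at h1
    rw [htr] at h2 h3
    exact ⟨h1, h2, h3⟩

theorem finite_frobNorm_le (T : ℝ) : {γ : SL2Z | frobNorm γ ≤ T}.Finite := by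
  rcases lt_or_ge T 0 with hT | hT
  · convert Set.finite_empty
    ext γ
    simp only [Set.mem_ofPred_eq, Set.mem_empty_iff_false, iff_false, not_le]
    exact hT.trans_le (Real.sqrt_nonneg _)
  let e : SL2Z → (ℤ × ℤ) × (ℤ × ℤ) := fun γ => ((γ 0 0, γ 0 1), (γ 1 0, γ 1 1))
  have he : Function.Injective e := by
    intro γ δ h
    simp only [e, Prod.mk.injEq] at h
    ext i j
    fin_cases i <;> fin_cases j
    · exact h.1.1
    · exact h.1.2
    · exact h.2.1
    · exact h.2.2
  let I : Set ℤ := Set.Icc (-⌊T⌋) ⌊T⌋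
  have hI : I.Finite := Set.finite_Icc _ _
  refine (((hI.prod hI).prod (hI.prod hI)).preimage he.injOn).subset fun γ hγ => ?_
  rw [Set.mem_ofPred_eq, frobNorm_le_iff γ hT] at hγ
  have key (z : ℤ) (hz : (z : ℝ) ^ 2 ≤ T ^ 2) : z ∈ I := by
    have h := abs_le_of_sq_le_sq hz hT
    rw [← Int.cast_abs, ← Int.le_floor] at h
    exact abs_le.1 h
  have h1 := sq_nonneg (γ 0 0 : ℝ)
  have h2 := sq_nonneg (γ 0 1 : ℝ)
  have h3 := sq_nonneg (γ 1 0 : ℝ)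
  have h4 := sq_nonneg (γ 1 1 : ℝ)
  exact ⟨⟨key _ (by linarith), key _ (by linarith)⟩, ⟨key _ (by linarith), key _ (by linarith)⟩⟩

/-- The matrices in the ball of radius `T` with normalized trace in `(α, β)`. -/
def traceSet (α β T : ℝ) : Set SL2Z :=
  {γ | frobNorm γ ≤ T ∧ α < (trZ γ : ℝ) / T ∧ (trZ γ : ℝ) / T < β}

theorem finite_traceSet (α β T : ℝ) : (traceSet α β T).Finite :=
  (finite_frobNorm_le T).subset fun _ h => h.1

open Classical in
theorem ncard_traceSet_pos {T : ℝ} (hT : 1 ≤ T) (α β : ℝ) :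
    ((traceSet α β T ∩ {γ | 0 < γ 0 0}).ncard : ℝ) =
      ∑' p : ℤ × ℤ, (((unitIndex T).filter fun i => paramPoint T i ∈ cellSet α β p).card : ℝ) := by
  have himg : traceSet α β T ∩ {γ | 0 < γ 0 0} = cellMatrix '' (cellMatrix ⁻¹' traceSet α β T) := by
    rw [Set.image_preimage_eq_inter_range, range_cellMatrix]
  have hfin : (cellMatrix ⁻¹' traceSet α β T).Finite :=
    (finite_traceSet α β T).preimage cellMatrix_injective.injOn
  have hcard (p : ℤ × ℤ) : (hfin.toFinset.filter fun w => w.1 = p).card =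
      ((unitIndex T).filter fun i => paramPoint T i ∈ cellSet α β p).card := by
    refine Eq.trans (congrArg Finset.card ?_)
      (Finset.card_map ⟨Prod.mk p, Prod.mk_right_injective p⟩)
    ext ⟨q, i⟩
    simp only [Finset.mem_filter, Set.Finite.mem_toFinset, Set.mem_preimage, Finset.mem_map,
      Function.Embedding.coeFn_mk, Prod.mk.injEq]
    constructor
    · rintro ⟨h, rfl⟩
      exact ⟨i, (cellMatrix_mem_iff hT α β q i).1 h, rfl, rfl⟩
    · rintro ⟨j, h, rfl, rfl⟩
      exact ⟨(cellMatrix_mem_iff hT α β p j).2 h, rfl⟩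
  rw [himg, Set.ncard_image_of_injective _ cellMatrix_injective, Set.ncard_eq_toFinset_card _ hfin,
    tsum_eq_sum (s := hfin.toFinset.image Prod.fst), Finset.card_eq_sum_card_image Prod.fst,
    Nat.cast_sum]
  · exact Finset.sum_congr rfl fun p _ => by rw [hcard]
  · intro p hp
    rw [← hcard, Nat.cast_eq_zero, Finset.card_eq_zero, Finset.filter_eq_empty_iff]
    rintro w hw rfl
    exact hp (Finset.mem_image_of_mem _ hw)

theorem InRegion.sq_mul_le {α β s x y t : ℝ} (h : InRegion α β s x y t) (hs : 0 ≤ s) (hsx : s ≤ x) :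
    x ^ 2 * (1 + y ^ 2) * (1 + t ^ 2) ≤ 3 := by
  obtain ⟨hx, hn, -⟩ := h
  have hB0 : 0 ≤ s ^ 2 / x := by positivity
  have hB : s ^ 2 / x ≤ x := by
    rw [div_le_iff₀ hx]; nlinarith
  have hid : normForm s x y t =
      x ^ 2 * (1 + y ^ 2 + t ^ 2) + (x * y * t + s ^ 2 / x) ^ 2 := by
    rw [normForm]; field_simp; ring
  rw [hid] at hn
  set B := s ^ 2 / x
  have hB2 : B ^ 2 ≤ x ^ 2 := pow_le_pow_left₀ hB0 hB 2
  nlinarith [sq_nonneg (x * y * t + 2 * B), sq_nonneg (x * y), sq_nonneg (x * t)]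

theorem one_add_sq_le_of_mem_Ico {i f : ℝ} (hf : f ∈ Set.Ico (0 : ℝ) 1) :
    1 + i ^ 2 ≤ 3 * (1 + (i + f) ^ 2) := by
  nlinarith [hf.1, hf.2, sq_nonneg (i + 2 * f)]

theorem circleRep_mem (u : UnitAddCircle) : circleRep u ∈ Set.Ico (0 : ℝ) 1 := by
  simpa [circleRep] using (AddCircle.equivIco 1 0 u).2

theorem card_unitIndex_le {Q : ℝ} (hQ : 0 ≤ Q) : ((unitIndex Q).card : ℝ) ≤ Q ^ 2 := by
  rw [card_unitIndex]
  calc ∑ n ∈ Finset.Ioc 0 ⌊Q⌋₊, (n.totient : ℝ) ≤ ∑ n ∈ Finset.Ioc 0 ⌊Q⌋₊, Q := by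
        refine Finset.sum_le_sum fun n hn => ?_
        have h1 : (n.totient : ℝ) ≤ n := by exact_mod_cast Nat.totient_le n
        exact h1.trans ((Nat.le_floor_iff hQ).1 (Finset.mem_Ioc.1 hn).2)
    _ = ⌊Q⌋₊ * Q := by simp
    _ ≤ Q * Q := by gcongr; exact Nat.floor_le hQ
    _ = Q ^ 2 := by ring

open Classical in
theorem card_cell_le {T : ℝ} (hT : 1 ≤ T) (α β : ℝ) (p : ℤ × ℤ) :
    (((unitIndex T).filter fun i => paramPoint T i ∈ cellSet α β p).card : ℝ) ≤
      27 * T ^ 2 * ((1 + (p.1 : ℝ) ^ 2)⁻¹ * (1 + (p.2 : ℝ) ^ 2)⁻¹) := by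
  have hT0 : 0 < T := by linarith
  set D := (1 + (p.1 : ℝ) ^ 2) * (1 + (p.2 : ℝ) ^ 2) with hD
  have hD0 : 0 < D := by positivity
  set Q := Real.sqrt (27 * T ^ 2 / D)
  have hQ2 : Q ^ 2 = 27 * T ^ 2 / D := Real.sq_sqrt (by positivity)
  have hsub : ((unitIndex T).filter fun i => paramPoint T i ∈ cellSet α β p) ⊆ unitIndex Q := by
    rintro ⟨n, u⟩ h
    obtain ⟨h1, h2⟩ := Finset.mem_filter.1 h
    have hnT : ((n + 1 : ℕ) : ℝ) ≤ T :=
      (Nat.le_floor_iff hT0.le).1 (Finset.mem_range.1 (Finset.mem_sigma.1 h1).1)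
    have hs : ((paramPoint T ⟨n, u⟩).1.1 : ℝ) = 1 / T := by
      simp only [paramPoint]
      rw [Set.projIcc_of_mem zero_le_one (show 1 / T ∈ Set.Icc (0 : ℝ) 1 from
        ⟨by positivity, by rw [div_le_one hT0]; exact hT⟩)]
    have hx : ((paramPoint T ⟨n, u⟩).1.2 : ℝ) = ((n + 1 : ℕ) : ℝ) / T := by
      simp only [paramPoint]
      rw [Set.projIcc_of_mem zero_le_one (show ((n + 1 : ℕ) : ℝ) / T ∈ Set.Icc (0 : ℝ) 1 from
        ⟨by positivity, by rw [div_le_one hT0]; exact hnT⟩)]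
    have h3 : InRegion α β _ _ _ _ := h2
    rw [hs, hx] at h3
    have h4 := h3.sq_mul_le (by positivity) (by gcongr; simp)
    have h5 := one_add_sq_le_of_mem_Ico (i := p.1) (circleRep_mem (paramPoint T ⟨n, u⟩).2.1)
    have h6 := one_add_sq_le_of_mem_Ico (i := p.2) (circleRep_mem (paramPoint T ⟨n, u⟩).2.2)
    have h7 := mul_le_mul h5 h6 (by positivity) (by positivity)
    have h8 : ((n + 1 : ℕ) : ℝ) ^ 2 ≤ 27 * T ^ 2 / D := by
      rw [le_div_iff₀ hD0]
      rw [div_pow, mul_assoc, div_mul_eq_mul_div, div_le_iff₀ (by positivity)] at h4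
      rw [← hD] at h7
      have := mul_le_mul_of_nonneg_left h7 (sq_nonneg ((n + 1 : ℕ) : ℝ))
      nlinarith
    have h9 : ((n + 1 : ℕ) : ℝ) ≤ Q := Real.le_sqrt_of_sq_le h8
    exact Finset.mem_sigma.2 ⟨Finset.mem_range.2 ((Nat.le_floor_iff (Real.sqrt_nonneg _)).2 h9),
      Finset.mem_univ _⟩
  calc _ ≤ ((unitIndex Q).card : ℝ) := by exact_mod_cast Finset.card_le_card hsub
    _ ≤ Q ^ 2 := card_unitIndex_le (Real.sqrt_nonneg _)
    _ = _ := by rw [hQ2, hD, div_eq_mul_inv, mul_inv]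

theorem summable_inv_one_add_sq : Summable fun n : ℤ => (1 + (n : ℝ) ^ 2)⁻¹ := by
  refine Summable.of_norm_bounded_eventually (Real.summable_one_div_int_pow.2 one_lt_two) ?_
  rw [Filter.eventually_cofinite]
  refine (Set.finite_singleton (0 : ℤ)).subset fun n hn => ?_
  by_contra h
  have h0 : (n : ℝ) ≠ 0 := by exact_mod_cast h
  refine hn ?_
  rw [Real.norm_of_nonneg (by positivity), one_div]
  exact inv_anti₀ (by positivity) (by linarith)

theorem summable_cell_bound :
    Summable fun p : ℤ × ℤ => (1 + (p.1 : ℝ) ^ 2)⁻¹ * (1 + (p.2 : ℝ) ^ 2)⁻¹ :=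
  summable_inv_one_add_sq.mul_of_nonneg summable_inv_one_add_sq
    (fun n => by positivity) fun n => by positivity

/-- The limiting density of the matrices in `traceSet α β T` with positive upper left entry. -/
def limitDensity (α β : ℝ) : ℝ :=
  ∑' p : ℤ × ℤ, cellMeasure.real {w | InRegion α β 0 w.1 (p.1 + w.2.1) (p.2 + w.2.2)}

theorem eventually_le_card_unitIndex :
    ∀ᶠ T : ℝ in atTop, moebiusConst / 4 * T ^ 2 ≤ (unitIndex T).card := by
  have h := tendsto_card_unitIndex.eventually (eventually_gt_nhds
    (show moebiusConst / 4 < moebiusConst / 2 by linarith [moebiusConst_pos]))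
  filter_upwards [h, eventually_gt_atTop 0] with T hT hT0
  rw [lt_div_iff₀ (by positivity)] at hT
  exact hT.le


open Classical in
theorem tendsto_ncard_traceSet_pos (α β : ℝ) :
    Tendsto (fun T : ℝ => ((traceSet α β T ∩ {γ | 0 < γ 0 0}).ncard : ℝ) / (unitIndex T).card) atTop
      (𝓝 (limitDensity α β)) := by
  have hC := moebiusConst_pos
  have h := tendsto_tsum_of_dominated_convergence (𝓕 := atTop)
    (f := fun (T : ℝ) (p : ℤ × ℤ) =>
      (((unitIndex T).filter fun i => paramPoint T i ∈ cellSet α β p).card : ℝ) /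
        (unitIndex T).card)
    (summable_cell_bound.mul_left (108 / moebiusConst)) (tendsto_card_cell α β) (by
      filter_upwards [eventually_le_card_unitIndex, eventually_ge_atTop 1] with T h1 hT p
      have hT0 : 0 < T := by linarith
      rw [Real.norm_of_nonneg (by positivity)]
      have h2 := card_cell_le hT α β p
      calc _ ≤ 27 * T ^ 2 * ((1 + (p.1 : ℝ) ^ 2)⁻¹ * (1 + (p.2 : ℝ) ^ 2)⁻¹) /
            (moebiusConst / 4 * T ^ 2) := by gcongr
        _ = _ := by field_simp; norm_num)
  refine h.congr' ?_
  filter_upwards [eventually_ge_atTop 1] with T hT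
  rw [ncard_traceSet_pos hT, tsum_div_const]

theorem tsum_lintegral_Ico_int_add {f : ℝ → ENNReal} :
    ∑' n : ℤ, ∫⁻ u in Set.Ico (0 : ℝ) 1, f (n + u) = ∫⁻ y, f y := by
  rw [← setLIntegral_univ f, ← iUnion_Ico_intCast ℝ,
    lintegral_iUnion (fun n => measurableSet_Ico) (Set.pairwise_disjoint_Ico_intCast ℝ)]
  congr 1
  ext n
  rw [← lintegral_indicator measurableSet_Ico, ← lintegral_indicator measurableSet_Ico,
    ← lintegral_add_left_eq_self ((Set.Ico (n : ℝ) (n + 1)).indicator f) (n : ℝ)]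
  congr 1
  ext u
  simp [Set.indicator_apply]

theorem tsum_lintegral_Ico_prod_int_add {f : ℝ → ℝ → ENNReal}
    (hf : Measurable (Function.uncurry f)) :
    ∑' p : ℤ × ℤ, ∫⁻ u in Set.Ico (0 : ℝ) 1, ∫⁻ v in Set.Ico (0 : ℝ) 1, f (p.1 + u) (p.2 + v) =
      ∫⁻ y, ∫⁻ t, f y t := by
  rw [ENNReal.tsum_prod (f := fun m n : ℤ => ∫⁻ u in Set.Ico (0 : ℝ) 1,
    ∫⁻ v in Set.Ico (0 : ℝ) 1, f (m + u) (n + v))]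
  have h (m : ℤ) : ∑' n : ℤ, ∫⁻ u in Set.Ico (0 : ℝ) 1, ∫⁻ v in Set.Ico (0 : ℝ) 1,
      f (m + u) (n + v) = ∫⁻ u in Set.Ico (0 : ℝ) 1, ∫⁻ t, f (m + u) t := by
    rw [← lintegral_tsum]
    · exact lintegral_congr fun u => tsum_lintegral_Ico_int_add
    · intro n
      refine Measurable.aemeasurable (Measurable.lintegral_prod_right'
        (f := fun w : ℝ × ℝ => f (m + w.1) (n + w.2)) ?_)
      exact hf.comp (f := fun w : ℝ × ℝ => ((m : ℝ) + w.1, (n : ℝ) + w.2)) (by fun_prop)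
  simp only [h]
  exact tsum_lintegral_Ico_int_add (f := fun y => ∫⁻ t, f y t)

/-- The indicator of the limiting region in the coordinates `x = a/T`, `y = b/a`, `t = c/a`. -/
def regionIndicator (α β x y t : ℝ) : ENNReal :=
  {w : ℝ × ℝ × ℝ | InRegion α β 0 w.1 w.2.1 w.2.2}.indicator 1 (x, y, t)

theorem measurable_regionIndicator {Ω : Type*} [MeasurableSpace Ω] (α β : ℝ) {x y t : Ω → ℝ}
    (hx : Measurable x) (hy : Measurable y) (ht : Measurable t) :
    Measurable fun ω => regionIndicator α β (x ω) (y ω) (t ω) :=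
  ((measurable_one (α := ENNReal)).indicator (measurableSet_inRegion α β measurable_const
    measurable_fst measurable_snd.fst measurable_snd.snd)).comp (hx.prodMk (hy.prodMk ht))

theorem cellMeasure_inRegion (α β : ℝ) (p : ℤ × ℤ) :
    cellMeasure {w | InRegion α β 0 w.1 (p.1 + w.2.1) (p.2 + w.2.2)} =
      ∫⁻ x, (∫⁻ u in Set.Ico (0 : ℝ) 1, ∫⁻ v in Set.Ico (0 : ℝ) 1,
        regionIndicator α β x (p.1 + u) (p.2 + v)) ∂radialMeasure := by
  have hm : Measurable fun w : ℝ × ℝ × ℝ =>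
      regionIndicator α β w.1 (p.1 + w.2.1) (p.2 + w.2.2) :=
    measurable_regionIndicator α β (by fun_prop) (by fun_prop) (by fun_prop)
  rw [← lintegral_indicator_one (measurableSet_inRegion α β measurable_const (by fun_prop)
    (by fun_prop) (by fun_prop))]
  change ∫⁻ w, regionIndicator α β w.1 (p.1 + w.2.1) (p.2 + w.2.2) ∂cellMeasure = _
  rw [cellMeasure, lintegral_prod _ hm.aemeasurable]
  refine lintegral_congr fun x => ?_
  exact lintegral_prod _ (measurable_regionIndicator α β (by fun_prop) (by fun_prop)
    (by fun_prop)).aemeasurable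

theorem tsum_cellMeasure (α β : ℝ) :
    ∑' p : ℤ × ℤ, cellMeasure {w | InRegion α β 0 w.1 (p.1 + w.2.1) (p.2 + w.2.2)} =
      ∫⁻ x in Set.Ioc (0 : ℝ) 1, ENNReal.ofReal (2 * x) *
        ∫⁻ y, ∫⁻ t, regionIndicator α β x y t := by
  simp only [cellMeasure_inRegion]
  rw [← lintegral_tsum, ← lintegral_radialMeasure]
  · exact lintegral_congr fun x => tsum_lintegral_Ico_prod_int_add
      (measurable_regionIndicator α β (by fun_prop) (by fun_prop) (by fun_prop))
  · refine Measurable.lintegral_prod_right' (f := fun w : ℝ × ℝ => ∫⁻ t, regionIndicator α β w.1 w.2 t) ?_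
    refine Measurable.lintegral_prod_right'
      (f := fun w : (ℝ × ℝ) × ℝ => regionIndicator α β w.1.1 w.1.2 w.2) ?_
    exact measurable_regionIndicator α β (by fun_prop) (by fun_prop) (by fun_prop)
  · intro p
    refine Measurable.aemeasurable (Measurable.lintegral_prod_right' (f := fun w : ℝ × ℝ =>
      ∫⁻ v in Set.Ico (0 : ℝ) 1, regionIndicator α β w.1 (p.1 + w.2) (p.2 + v)) ?_)
    refine Measurable.lintegral_prod_right'
      (f := fun w : (ℝ × ℝ) × ℝ => regionIndicator α β w.1.1 (p.1 + w.1.2) (p.2 + w.2)) ?_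
    exact measurable_regionIndicator α β (by fun_prop) (by fun_prop) (by fun_prop)

/-- The slice of the limiting region at `c/a = t`, in the coordinates `a/T`, `b/T`, without the
condition `0 < a`. -/
def sliceSet (α β t : ℝ) : Set (ℝ × ℝ) :=
  {z | (z.1 ^ 2 + z.2 ^ 2) * (1 + t ^ 2) ≤ 1 ∧ α < z.1 + t * z.2 ∧ z.1 + t * z.2 < β}

/-- The indicator of `sliceSet α β t`. -/
def sliceIndicator (α β t x b : ℝ) : ENNReal := (sliceSet α β t).indicator 1 (x, b)

theorem measurable_sliceIndicator {Ω : Type*} [MeasurableSpace Ω] (α β : ℝ) {t x b : Ω → ℝ}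
    (ht : Measurable t) (hx : Measurable x) (hb : Measurable b) :
    Measurable fun ω => sliceIndicator α β (t ω) (x ω) (b ω) := by
  have h1 : Measurable fun ω => (x ω ^ 2 + b ω ^ 2) * (1 + t ω ^ 2) := by fun_prop
  have h2 : Measurable fun ω => x ω + t ω * b ω := by fun_prop
  have h : MeasurableSet {ω | (x ω, b ω) ∈ sliceSet α β (t ω)} :=
    (measurableSet_le h1 measurable_const).inter
      ((measurableSet_lt measurable_const h2).inter (measurableSet_lt h2 measurable_const))
  exact (measurable_one (α := ENNReal)).indicator h

theorem ofReal_mul_lintegral_comp {f : ℝ → ENNReal} (hf : Measurable f) {x : ℝ} (hx : 0 < x) :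
    ENNReal.ofReal x * ∫⁻ y, f (x * y) = ∫⁻ b, f b := by
  conv_rhs => rw [← Real.smul_map_volume_mul_left hx.ne']
  rw [lintegral_smul_measure, lintegral_map hf (by fun_prop), abs_of_pos hx, smul_eq_mul]

theorem regionIndicator_eq {α β x y t : ℝ} (hx : 0 < x) :
    regionIndicator α β x y t = sliceIndicator α β t x (x * y) := by
  have : (x, y, t) ∈ {w : ℝ × ℝ × ℝ | InRegion α β 0 w.1 w.2.1 w.2.2} ↔
      (x, x * y) ∈ sliceSet α β t := by
    simp only [sliceSet, Set.mem_ofPred_eq, InRegion, normForm_zero, trForm_zero, hx, true_and]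
    rw [show x + t * (x * y) = x * (1 + y * t) by ring, show (x ^ 2 + (x * y) ^ 2) * (1 + t ^ 2) =
      x ^ 2 * (1 + y ^ 2) * (1 + t ^ 2) by ring]
  exact Set.indicator_eq_indicator this rfl

theorem tsum_cellMeasure_eq_slice (α β : ℝ) :
    ∑' p : ℤ × ℤ, cellMeasure {w | InRegion α β 0 w.1 (p.1 + w.2.1) (p.2 + w.2.2)} =
      2 * ∫⁻ t, ∫⁻ x in Set.Ioi 0, ∫⁻ b, sliceIndicator α β t x b := by
  rw [tsum_cellMeasure]
  have hx (x : ℝ) (hx : 0 < x) :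
      ENNReal.ofReal (2 * x) * ∫⁻ y, ∫⁻ t, regionIndicator α β x y t =
        2 * ∫⁻ t, ∫⁻ b, sliceIndicator α β t x b := by
    rw [ENNReal.ofReal_mul zero_le_two, mul_assoc, ENNReal.ofReal_ofNat, lintegral_lintegral_swap
      (measurable_regionIndicator α β measurable_const measurable_fst measurable_snd).aemeasurable,
      ← lintegral_const_mul]
    · congr 1
      refine lintegral_congr fun t => ?_
      simp only [regionIndicator_eq hx]
      exact ofReal_mul_lintegral_comp
        (measurable_sliceIndicator α β measurable_const measurable_const measurable_id) hx
    · refine Measurable.lintegral_prod_right'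
        (f := fun w : ℝ × ℝ => regionIndicator α β x w.2 w.1) ?_
      exact measurable_regionIndicator α β measurable_const measurable_snd measurable_fst
  have hm : Measurable fun w : ℝ × ℝ => ∫⁻ b, sliceIndicator α β w.2 w.1 b :=
    Measurable.lintegral_prod_right' (f := fun w : (ℝ × ℝ) × ℝ => sliceIndicator α β w.1.2 w.1.1 w.2)
      (measurable_sliceIndicator α β (by fun_prop) (by fun_prop) (by fun_prop))
  have hsub : Set.Ioc (0 : ℝ) 1 ⊆ Set.Ioi 0 := fun x hx => hx.1
  rw [setLIntegral_congr_fun measurableSet_Ioc fun x h => hx x h.1,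
    lintegral_lintegral_swap (f := fun t x => ∫⁻ b, sliceIndicator α β t x b)
      (hm.comp measurable_swap).aemeasurable, ← lintegral_const_mul _ hm.lintegral_prod_right',
    ← lintegral_indicator measurableSet_Ioc, ← lintegral_indicator measurableSet_Ioi]
  refine lintegral_congr fun x => ?_
  by_cases h1 : x ∈ Set.Ioc (0 : ℝ) 1
  · rw [Set.indicator_of_mem h1, Set.indicator_of_mem (hsub h1)]
  rw [Set.indicator_of_notMem h1]
  by_cases h2 : x ∈ Set.Ioi (0 : ℝ)
  · rw [Set.indicator_of_mem h2]
    have h3 : 1 < x := by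
      by_contra h; exact h1 ⟨h2, not_lt.1 h⟩
    have h4 (t b : ℝ) : sliceIndicator α β t x b = 0 := by
      refine Set.indicator_of_notMem (fun h => ?_) _
      have : (x ^ 2 + b ^ 2) * (1 + t ^ 2) ≤ 1 := h.1
      nlinarith [sq_nonneg b, sq_nonneg t, mul_nonneg (add_nonneg (sq_nonneg x) (sq_nonneg b)) (sq_nonneg t)]
    simp [h4]
  · rw [Set.indicator_of_notMem h2]

theorem sliceIndicator_neg (α β t x b : ℝ) :
    sliceIndicator (-β) (-α) t x b = sliceIndicator α β t (-x) (-b) := by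
  have : (x, b) ∈ sliceSet (-β) (-α) t ↔ (-x, -b) ∈ sliceSet α β t := by
    simp only [sliceSet, Set.mem_ofPred_eq, neg_sq]
    constructor <;> rintro ⟨h1, h2, h3⟩ <;> exact ⟨h1, by linarith, by linarith⟩
  exact Set.indicator_eq_indicator this rfl

theorem lintegral_Ioi_add_lintegral_Ioi_neg {g : ℝ → ENNReal} :
    (∫⁻ x in Set.Ioi 0, g x) + ∫⁻ x in Set.Ioi 0, g (-x) = ∫⁻ x, g x := by
  have h : ∫⁻ x in Set.Ioi 0, g (-x) = ∫⁻ x in Set.Iic 0, g x := by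
    rw [← Measure.restrict_congr_set Iio_ae_eq_Iic, ← lintegral_indicator measurableSet_Ioi,
      ← lintegral_indicator measurableSet_Iio, ← lintegral_neg_eq_self]
    refine lintegral_congr fun x => ?_
    simp [Set.indicator_apply]
  rw [h, ← Set.compl_Ioi]
  exact lintegral_add_compl g measurableSet_Ioi

theorem volume_sliceSet (α β t : ℝ) :
    volume (sliceSet α β t) = ENNReal.ofReal ((1 + t ^ 2)⁻¹) * volume (sliceSet α β 0) := by
  have ht : (0 : ℝ) < 1 + t ^ 2 := by positivity
  set φ := Matrix.toLin (Module.Basis.finTwoProd ℝ) (Module.Basis.finTwoProd ℝ) !![1, t; -t, 1]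
  have hdet : LinearMap.det φ = 1 + t ^ 2 := by
    rw [LinearMap.det_toLin, Matrix.det_fin_two_of]; ring
  have h := Measure.addHaar_preimage_linearMap (volume : Measure (ℝ × ℝ)) (f := φ)
    (by rw [hdet]; exact ht.ne') (sliceSet α β 0)
  rw [hdet, abs_of_pos (inv_pos.2 ht)] at h
  rw [← h]
  congr 1
  ext ⟨x, b⟩
  have : φ (x, b) = (x + t * b, -t * x + b) := by
    rw [Matrix.toLin_finTwoProd_apply]; simp
  simp only [Set.mem_preimage, this, sliceSet, Set.mem_ofPred_eq]
  ring_nf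

theorem lintegral_ofReal_inv_one_add_sq :
    ∫⁻ t : ℝ, ENNReal.ofReal ((1 + t ^ 2)⁻¹) = ENNReal.ofReal Real.pi := by
  rw [← integral_univ_inv_one_add_sq, ofReal_integral_eq_lintegral_ofReal integrable_inv_one_add_sq
    (ae_of_all _ fun t => by positivity)]

theorem measurableSet_sliceSet (α β t : ℝ) : MeasurableSet (sliceSet α β t) := by
  have h1 : Measurable fun z : ℝ × ℝ => (z.1 ^ 2 + z.2 ^ 2) * (1 + t ^ 2) := by fun_prop
  have h2 : Measurable fun z : ℝ × ℝ => z.1 + t * z.2 := by fun_prop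
  exact (measurableSet_le h1 measurable_const).inter
    ((measurableSet_lt measurable_const h2).inter (measurableSet_lt h2 measurable_const))

theorem lintegral_sliceIndicator (α β t : ℝ) :
    ∫⁻ x, ∫⁻ b, sliceIndicator α β t x b = volume (sliceSet α β t) := by
  rw [← lintegral_indicator_one (measurableSet_sliceSet α β t), Measure.volume_eq_prod,
    lintegral_prod _ (measurable_one.indicator (measurableSet_sliceSet α β t)).aemeasurable]
  rfl

theorem setIntegral_sqrt_one_sub_sq (α β : ℝ) :
    ∫ x in Set.Ioc (max α (-1)) (min β 1), Real.sqrt (1 - x ^ 2) =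
      ∫ x in Set.Ioo α β, Real.sqrt (1 - x ^ 2) := by
  rw [← integral_Ioc_eq_integral_Ioo]
  refine (setIntegral_eq_of_subset_of_forall_sdiff_eq_zero measurableSet_Ioc
    (Set.Ioc_subset_Ioc (le_max_left _ _) (min_le_left _ _)) fun x hx => ?_).symm
  refine Real.sqrt_eq_zero_of_nonpos ?_
  by_contra! h
  have h1 := (sq_lt_one_iff_abs_lt_one x).1 (by linarith)
  rw [abs_lt] at h1
  exact hx.2 ⟨max_lt hx.1.1 h1.1, le_min hx.1.2 h1.2.le⟩

theorem volume_sliceSet_zero (α β : ℝ) :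
    volume (sliceSet α β 0) = ENNReal.ofReal
      (2 * ∫ x in Set.Ioc (max α (-1)) (min β 1), Real.sqrt (1 - x ^ 2)) := by
  have hint : IntegrableOn (fun x : ℝ => 2 * Real.sqrt (1 - x ^ 2)) (Set.Ioo α β) :=
    ((by fun_prop : Continuous fun x : ℝ => 2 * Real.sqrt (1 - x ^ 2)).integrableOn_Icc).mono_set
      Set.Ioo_subset_Icc_self
  rw [setIntegral_sqrt_one_sub_sq, ← integral_const_mul, ofReal_integral_eq_lintegral_ofReal hint
    (ae_of_all _ fun x => by positivity), Measure.volume_eq_prod,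
    Measure.prod_apply (measurableSet_sliceSet α β 0), ← lintegral_indicator measurableSet_Ioo]
  refine lintegral_congr fun x => ?_
  by_cases hx : x ∈ Set.Ioo α β
  · rw [Set.indicator_of_mem hx]
    rcases lt_or_ge (1 - x ^ 2) 0 with h | h
    · rw [Real.sqrt_eq_zero_of_nonpos h.le, mul_zero, ENNReal.ofReal_zero]
      convert measure_empty
      · ext b
        simp only [sliceSet, Set.mem_preimage, Set.mem_ofPred_eq, Set.mem_empty_iff_false, iff_false]
        rintro ⟨h1, -⟩
        nlinarith [sq_nonneg b]
      · infer_instance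
    · have : Prod.mk x ⁻¹' sliceSet α β 0 =
          Set.Icc (-Real.sqrt (1 - x ^ 2)) (Real.sqrt (1 - x ^ 2)) := by
        ext b
        rw [Set.mem_Icc, ← abs_le, ← Real.sqrt_sq_eq_abs, Real.sqrt_le_sqrt_iff h]
        simp only [sliceSet, Set.mem_preimage, Set.mem_ofPred_eq]
        constructor
        · rintro ⟨h1, -⟩; linarith
        · exact fun h1 => ⟨by linarith, by simpa using hx.1, by simpa using hx.2⟩
      rw [this, Real.volume_Icc]
      ring_nf
  · rw [Set.indicator_of_notMem hx]
    convert measure_empty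
    · ext b
      simp only [sliceSet, Set.mem_preimage, Set.mem_ofPred_eq, Set.mem_empty_iff_false, iff_false]
      rintro ⟨-, h1, h2⟩
      exact hx ⟨by simpa using h1, by simpa using h2⟩
    · infer_instance

theorem limitDensity_eq_toReal (α β : ℝ) :
    limitDensity α β = (2 * ∫⁻ t, ∫⁻ x in Set.Ioi 0, ∫⁻ b, sliceIndicator α β t x b).toReal := by
  rw [← tsum_cellMeasure_eq_slice, ENNReal.tsum_toReal_eq fun p => measure_ne_top _ _]
  rfl

theorem limitDensity_add_limitDensity_neg (α β : ℝ) :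
    limitDensity α β + limitDensity (-β) (-α) =
      4 * Real.pi * ∫ x in Set.Ioc (max α (-1)) (min β 1), Real.sqrt (1 - x ^ 2) := by
  have hm : Measurable fun w : ℝ × ℝ => ∫⁻ b, sliceIndicator α β w.1 w.2 b :=
    Measurable.lintegral_prod_right' (f := fun w : (ℝ × ℝ) × ℝ => sliceIndicator α β w.1.1 w.1.2 w.2)
      (measurable_sliceIndicator α β (by fun_prop) (by fun_prop) (by fun_prop))
  have hneg (t x : ℝ) : ∫⁻ b, sliceIndicator (-β) (-α) t x b =
      ∫⁻ b, sliceIndicator α β t (-x) b := by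
    simp only [sliceIndicator_neg]
    exact lintegral_neg_eq_self _
  have hsum : 2 * (∫⁻ t, ∫⁻ x in Set.Ioi 0, ∫⁻ b, sliceIndicator α β t x b) +
      2 * (∫⁻ t, ∫⁻ x in Set.Ioi 0, ∫⁻ b, sliceIndicator (-β) (-α) t x b) = ENNReal.ofReal
        (4 * Real.pi * ∫ x in Set.Ioc (max α (-1)) (min β 1), Real.sqrt (1 - x ^ 2)) := by
    rw [← mul_add, ← lintegral_add_left hm.lintegral_prod_right']
    have hslice (t : ℝ) : (∫⁻ x in Set.Ioi 0, ∫⁻ b, sliceIndicator α β t x b) +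
        ∫⁻ x in Set.Ioi 0, ∫⁻ b, sliceIndicator (-β) (-α) t x b =
          ENNReal.ofReal ((1 + t ^ 2)⁻¹) * volume (sliceSet α β 0) := by
      simp only [hneg]
      rw [lintegral_Ioi_add_lintegral_Ioi_neg (g := fun x => ∫⁻ b, sliceIndicator α β t x b),
        lintegral_sliceIndicator, volume_sliceSet]
    simp only [hslice]
    rw [lintegral_mul_const _ (by fun_prop), lintegral_ofReal_inv_one_add_sq, volume_sliceSet_zero,
      ← ENNReal.ofReal_mul Real.pi_pos.le, ← ENNReal.ofReal_ofNat 2,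
      ← ENNReal.ofReal_mul zero_le_two]
    ring_nf
  have htop := ENNReal.add_ne_top.1 (hsum.trans_ne ENNReal.ofReal_ne_top)
  rw [limitDensity_eq_toReal, limitDensity_eq_toReal, ← ENNReal.toReal_add htop.1 htop.2, hsum,
    ENNReal.toReal_ofReal]
  have : 0 ≤ ∫ x in Set.Ioc (max α (-1)) (min β 1), Real.sqrt (1 - x ^ 2) :=
    integral_nonneg fun x => Real.sqrt_nonneg _
  positivity

theorem ncard_traceSet_neg (α β T : ℝ) :
    (traceSet α β T ∩ {γ | γ 0 0 < 0}).ncard = (traceSet (-β) (-α) T ∩ {γ | 0 < γ 0 0}).ncard := by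
  have hneg (γ : SL2Z) (i j : Fin 2) : (-γ) i j = -γ i j := rfl
  have hfrob (γ : SL2Z) : frobNorm (-γ) = frobNorm γ := by simp only [frobNorm, hneg, neg_sq]
  have htr (γ : SL2Z) : ((trZ (-γ) : ℤ) : ℝ) / T = -((trZ γ : ℝ) / T) := by
    rw [← neg_div, ← Int.cast_neg]
    congr 2
    simp only [trZ, hneg]
    ring
  rw [← Set.ncard_image_of_injective _ (neg_injective (G := SL2Z))]
  congr 1
  ext γ
  simp only [Set.image_neg_eq_neg, Set.mem_neg, Set.mem_inter_iff, traceSet, Set.mem_ofPred_eq,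
    hfrob, htr, hneg]
  constructor
  · rintro ⟨⟨h1, h2, h3⟩, h4⟩
    exact ⟨⟨h1, by linarith, by linarith⟩, by linarith⟩
  · rintro ⟨⟨h1, h2, h3⟩, h4⟩
    exact ⟨⟨h1, by linarith, by linarith⟩, by linarith⟩

theorem ncard_traceSet_zero_le {T : ℝ} (hT : 1 ≤ T) (α β : ℝ) :
    ((traceSet α β T ∩ {γ | γ 0 0 = 0}).ncard : ℝ) ≤ 6 * T := by
  have hT0 : 0 ≤ T := by linarith
  have hdet {γ : SL2Z} (h : γ 0 0 = 0) : γ 0 1 * γ 1 0 = -1 := by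
    have := (Matrix.det_fin_two _).symm.trans γ.det_coe
    rw [h] at this
    linarith
  have hfloor : 0 ≤ ⌊T⌋ := Int.floor_nonneg.2 hT0
  have hle : (traceSet α β T ∩ {γ | γ 0 0 = 0}).ncard ≤
      ((({1, -1} : Finset ℤ) ×ˢ Finset.Icc (-⌊T⌋) ⌊T⌋ : Finset (ℤ × ℤ)) : Set (ℤ × ℤ)).ncard := by
    refine Set.ncard_le_ncard_of_injOn (fun γ => (γ 0 1, γ 1 1)) ?_ ?_ (Finset.finite_toSet _)
    · rintro γ ⟨⟨hγ, -⟩, h0⟩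
      rw [frobNorm_le_iff γ hT0] at hγ
      have h1 := abs_le_of_sq_le_sq (a := (γ 1 1 : ℝ)) (b := T) (by
        nlinarith [sq_nonneg (γ 0 1 : ℝ), sq_nonneg (γ 1 0 : ℝ), sq_nonneg (γ 0 0 : ℝ)]) hT0
      rw [← Int.cast_abs, ← Int.le_floor, abs_le] at h1
      have h2 : IsUnit (γ 0 1) := IsUnit.of_mul_eq_one (-γ 1 0) (by linarith [hdet h0])
      rw [Int.isUnit_iff] at h2
      simpa using ⟨h2, h1⟩
    · rintro γ ⟨-, hγ⟩ δ ⟨-, hδ⟩ h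
      have hγ' : γ 0 0 = 0 := hγ
      have hδ' : δ 0 0 = 0 := hδ
      simp only [Prod.mk.injEq] at h
      have e1 := hdet hγ
      have e2 := hdet hδ
      have hb : γ 0 1 ≠ 0 := by
        intro h; rw [h] at e1; simp at e1
      have hc : γ 1 0 = δ 1 0 := mul_left_cancel₀ hb (by rw [e1, h.1, e2])
      ext i j
      fin_cases i <;> fin_cases j
      · exact hγ'.trans hδ'.symm
      · exact h.1
      · exact hc
      · exact h.2
  rw [Set.ncard_coe_finset, Finset.card_product, Int.card_Icc] at hle
  have h2 : (({1, -1} : Finset ℤ)).card = 2 := rfl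
  rw [h2] at hle
  have h3 : ((traceSet α β T ∩ {γ | γ 0 0 = 0}).ncard : ℤ) ≤ 2 * (2 * ⌊T⌋ + 1) := by omega
  have h4 : ((traceSet α β T ∩ {γ | γ 0 0 = 0}).ncard : ℝ) ≤ 2 * (2 * ⌊T⌋ + 1) := by
    exact_mod_cast h3
  linarith [Int.floor_le T]

theorem tendsto_ncard_traceSet_zero (α β : ℝ) :
    Tendsto (fun T : ℝ => ((traceSet α β T ∩ {γ | γ 0 0 = 0}).ncard : ℝ) / (unitIndex T).card) atTop
      (𝓝 0) := by
  have hC := moebiusConst_pos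
  refine squeeze_zero' (g := fun T : ℝ => 24 / moebiusConst / T)
    (Eventually.of_forall fun T => by positivity) ?_ (tendsto_const_nhds.div_atTop tendsto_id)
  filter_upwards [eventually_le_card_unitIndex, eventually_ge_atTop 1] with T h1 hT
  have hT0 : 0 < T := by linarith
  calc _ ≤ 6 * T / (moebiusConst / 4 * T ^ 2) := by
        gcongr; exact ncard_traceSet_zero_le hT α β
    _ = _ := by field_simp; norm_num

theorem ncard_traceSet (α β T : ℝ) :
    (traceSet α β T).ncard = (traceSet α β T ∩ {γ | 0 < γ 0 0}).ncard +
      (traceSet (-β) (-α) T ∩ {γ | 0 < γ 0 0}).ncard +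
        (traceSet α β T ∩ {γ | γ 0 0 = 0}).ncard := by
  have hfin := finite_traceSet α β T
  rw [← ncard_traceSet_neg, ← Set.ncard_union_eq _ (hfin.inter_of_left _) (hfin.inter_of_left _),
    ← Set.ncard_union_eq _ ((hfin.inter_of_left _).union (hfin.inter_of_left _))
      (hfin.inter_of_left _)]
  · congr 1
    ext γ
    have : 0 < γ 0 0 ∨ γ 0 0 < 0 ∨ γ 0 0 = 0 := by omega
    simp only [Set.mem_union, Set.mem_inter_iff, Set.mem_ofPred_eq]
    tauto
  · rw [Set.disjoint_left]
    rintro γ (⟨-, h⟩ | ⟨-, h⟩) ⟨-, h'⟩ <;> simp only [Set.mem_ofPred_eq] at h h' <;> omega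
  · rw [Set.disjoint_left]
    rintro γ ⟨-, h⟩ ⟨-, h'⟩
    simp only [Set.mem_ofPred_eq] at h h'
    omega

theorem tendsto_ncard_traceSet (α β : ℝ) :
    Tendsto (fun T : ℝ => ((traceSet α β T).ncard : ℝ) / (unitIndex T).card) atTop
      (𝓝 (4 * Real.pi * ∫ x in Set.Ioc (max α (-1)) (min β 1), Real.sqrt (1 - x ^ 2))) := by
  have h := ((tendsto_ncard_traceSet_pos α β).add (tendsto_ncard_traceSet_pos (-β) (-α))).add
    (tendsto_ncard_traceSet_zero α β)
  rw [limitDensity_add_limitDensity_neg, add_zero] at h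
  refine h.congr fun T => ?_
  rw [ncard_traceSet]
  push_cast
  ring

theorem traceSet_neg_two_two {T : ℝ} (hT : 0 < T) :
    traceSet (-2) 2 T = {γ | frobNorm γ ≤ T} := by
  ext γ
  refine ⟨fun h => h.1, fun h => ⟨h, ?_⟩⟩
  rw [← abs_lt, abs_div, abs_of_pos hT, div_lt_iff₀ hT]
  refine abs_lt_of_sq_lt_sq ?_ (by positivity)
  have h1 := (frobNorm_le_iff γ hT.le).1 h
  rw [trZ]
  push_cast
  nlinarith [sq_nonneg ((γ 0 0 : ℝ) - γ 1 1), sq_nonneg (γ 0 1 : ℝ), sq_nonneg (γ 1 0 : ℝ)]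

theorem tendsto_ncard_frobNorm_le :
    Tendsto (fun T : ℝ => ({γ : SL2Z | frobNorm γ ≤ T}.ncard : ℝ) / (unitIndex T).card) atTop
      (𝓝 (2 * Real.pi ^ 2)) := by
  have h := tendsto_ncard_traceSet (-2) 2
  rw [max_eq_right (by norm_num), min_eq_right (by norm_num),
    ← intervalIntegral.integral_of_le (by norm_num), integral_sqrt_one_sub_sq] at h
  rw [show 2 * Real.pi ^ 2 = 4 * Real.pi * (Real.pi / 2) by ring]
  refine h.congr' ?_
  filter_upwards [eventually_gt_atTop 0] with T hT
  rw [traceSet_neg_two_two hT]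

/-- For all real `α < β`, the proportion of `γ ∈ Γ_T` with `Tr(γ)/T ∈ (α,β)` converges to
`(2/π) ∫_{max(α,-1)}^{min(β,1)} √(1-x²) dx` as `T → ∞`. -/
theorem statement0 (α β : ℝ) (h : α < β) :
    Tendsto (fun T : ℝ =>
        (Nat.card {γ : SL2Z // frobNorm γ ≤ T ∧
            α < (trZ γ : ℝ) / T ∧ (trZ γ : ℝ) / T < β} : ℝ) /
          (Nat.card {γ : SL2Z // frobNorm γ ≤ T} : ℝ))
      atTop
      (𝓝 ((2 / Real.pi) *
        ∫ x in Set.Ioc (max α (-1)) (min β 1), Real.sqrt (1 - x ^ 2))) := by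
  have hpi := Real.pi_pos
  have key := (tendsto_ncard_traceSet α β).div tendsto_ncard_frobNorm_le (by positivity)
  have hlim (I : ℝ) : 4 * Real.pi * I / (2 * Real.pi ^ 2) = 2 / Real.pi * I := by
    field_simp
    ring
  rw [hlim] at key
  refine key.congr' ?_
  filter_upwards [eventually_ge_atTop 1] with T hT
  have := card_unitIndex_pos hT
  exact div_div_div_cancel_right₀ (by positivity) _ _
end
end

section
/- For every η > 0 there exists a constant C_η > 0 such that for every integer t and every real T ≥ 2, the number of matrices γ ∈ SL(2,ℤ) with Frobenius norm ‖γ‖ ≤ T and Tr(γ) = t is at most C_η · T^{1+η}. -/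
noncomputable section

open Matrix Filter Topology

/-- The divisor bound: the number of divisors of `n` is `O(n ^ ε)` for every `ε > 0`. -/
theorem exists_card_divisors_le_rpow {ε : ℝ} (hε : 0 < ε) :
    ∃ C : ℝ, 0 < C ∧ ∀ n : ℕ, n ≠ 0 → (n.divisors.card : ℝ) ≤ C * (n : ℝ) ^ ε := by
  have hlog : 0 < Real.log 2 := Real.log_pos (by norm_num)
  set P : ℕ := ⌈(2 : ℝ) ^ (1 / ε)⌉₊
  set K : ℝ := 1 + 1 / (ε * Real.log 2) with hK
  have hK1 : 1 ≤ K := by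
    have : 0 < 1 / (ε * Real.log 2) := by positivity
    linarith
  refine ⟨K ^ P, by positivity, fun n hn => ?_⟩
  have hlocal : ∀ p ∈ n.primeFactors, ((n.factorization p : ℝ) + 1) ≤
      (if p < P then K else 1) * ((p : ℝ) ^ n.factorization p) ^ ε := by
    intro p hp
    have hp2 : (2 : ℝ) ≤ p := by exact_mod_cast (Nat.prime_of_mem_primeFactors hp).two_le
    set v := n.factorization p
    have hcomm : ((p : ℝ) ^ v) ^ ε = ((p : ℝ) ^ ε) ^ v :=
      (Real.rpow_pow_comm (by positivity) ε v).symm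
    split_ifs with hpP
    · have h2p : ((2 : ℝ) ^ v) ^ ε ≤ ((p : ℝ) ^ v) ^ ε := by gcongr
      have hexp : v * (ε * Real.log 2) + 1 ≤ ((2 : ℝ) ^ v) ^ ε := by
        rw [Real.rpow_def_of_pos (by positivity), Real.log_pow]
        convert Real.add_one_le_exp _ using 2
        ring
      calc (v : ℝ) + 1 ≤ K * (v * (ε * Real.log 2) + 1) := by
            have : K * (v * (ε * Real.log 2) + 1)
                = v + 1 + (v * (ε * Real.log 2) + 1 / (ε * Real.log 2)) := by
              rw [hK]; field_simp; ring
            rw [this]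
            have : 0 ≤ v * (ε * Real.log 2) + 1 / (ε * Real.log 2) := by positivity
            linarith
        _ ≤ _ := by gcongr; exact hexp.trans h2p
    · have hle : (2 : ℝ) ≤ (p : ℝ) ^ ε := by
        have h1 : (2 : ℝ) ^ (1 / ε) ≤ p :=
          (Nat.le_ceil _).trans (by exact_mod_cast not_lt.mp hpP)
        calc (2 : ℝ) = ((2 : ℝ) ^ (1 / ε)) ^ ε := by
              rw [← Real.rpow_mul (by norm_num), one_div_mul_cancel hε.ne', Real.rpow_one]
          _ ≤ _ := by gcongr
      rw [one_mul, hcomm]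
      calc (v : ℝ) + 1 ≤ 2 ^ v := by exact_mod_cast Nat.succ_le_of_lt v.lt_two_pow_self
        _ ≤ _ := by gcongr
  have hconst : ∏ p ∈ n.primeFactors, (if p < P then K else 1) ≤ K ^ P := by
    rw [← Finset.prod_filter, Finset.prod_const]
    refine pow_le_pow_right₀ hK1 ?_
    calc _ ≤ (Finset.range P).card := Finset.card_le_card fun p hp => by
          simpa using (Finset.mem_filter.mp hp).2
      _ = P := Finset.card_range P
  have hprod : ∏ p ∈ n.primeFactors, ((p : ℝ) ^ n.factorization p) ^ ε = (n : ℝ) ^ ε := by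
    rw [Real.finsetProd_rpow _ _ fun _ _ => by positivity]
    congr 1
    exact_mod_cast Nat.prod_factorization_pow_eq_self hn
  rw [Nat.card_divisors hn]
  push_cast
  calc _ ≤ ∏ p ∈ n.primeFactors,
        (if p < P then K else 1) * ((p : ℝ) ^ n.factorization p) ^ ε :=
        Finset.prod_le_prod (fun _ _ => by positivity) hlocal
    _ ≤ _ := by
        rw [Finset.prod_mul_distrib, hprod]
        gcongr

/-- The positive and negative divisors of an integer (none for `0`). -/
def signedDivisors (n : ℤ) : Finset ℤ :=
  n.natAbs.divisors.image (fun d : ℕ => (d : ℤ)) ∪ n.natAbs.divisors.image (fun d : ℕ => -(d : ℤ))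

theorem mem_signedDivisors {n b : ℤ} (hn : n ≠ 0) (hb : b ∣ n) : b ∈ signedDivisors n := by
  have hd : b.natAbs ∈ n.natAbs.divisors :=
    Nat.mem_divisors.mpr ⟨Int.natAbs_dvd_natAbs.mpr hb, Int.natAbs_ne_zero.mpr hn⟩
  rw [signedDivisors, Finset.mem_union, Finset.mem_image, Finset.mem_image]
  rcases Int.natAbs_eq b with h | h
  · exact Or.inl ⟨_, hd, h.symm⟩
  · exact Or.inr ⟨_, hd, h.symm⟩

theorem card_signedDivisors_le (n : ℤ) :
    (signedDivisors n).card ≤ 2 * n.natAbs.divisors.card := by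
  rw [two_mul]
  exact (Finset.card_union_le _ _).trans (add_le_add Finset.card_image_le Finset.card_image_le)

/-- The triples `(a, b, c)` with `bc = 0` and `a = ±1`, where `|b|, |c| ≤ N`. -/
def degenerateTriples (N : ℕ) : Finset (ℤ × ℤ × ℤ) :=
  {1, -1} ×ˢ ({0} ×ˢ Finset.Icc (-N : ℤ) N ∪ Finset.Icc (-N : ℤ) N ×ˢ {0})

/-- The triples `(a, b, c)` with `bc = a (t - a) - 1 ≠ 0`, where `|a| ≤ N` and `|bc| ≤ N ^ 2`. -/
def nondegenerateTriples (t : ℤ) (N : ℕ) : Finset (ℤ × ℤ × ℤ) :=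
  ((Finset.Icc (-N : ℤ) N).filter fun a => (a * (t - a) - 1).natAbs ≤ N ^ 2).biUnion fun a =>
    (signedDivisors (a * (t - a) - 1)).image fun b => (a, b, (a * (t - a) - 1) / b)

theorem card_Icc_neg_self (N : ℕ) : (Finset.Icc (-N : ℤ) N).card = 2 * N + 1 := by
  rw [Int.card_Icc]; omega

theorem card_degenerateTriples_le (N : ℕ) :
    (degenerateTriples N).card ≤ 4 * (2 * N + 1) := by
  have h := Finset.card_union_le ({(0 : ℤ)} ×ˢ Finset.Icc (-N : ℤ) N)
    (Finset.Icc (-N : ℤ) N ×ˢ {(0 : ℤ)})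
  rw [Finset.card_product, Finset.card_product, card_Icc_neg_self, Finset.card_singleton] at h
  rw [degenerateTriples, Finset.card_product, show ({1, -1} : Finset ℤ).card = 2 from rfl]
  omega

theorem card_nondegenerateTriples_le (t : ℤ) {N : ℕ} {C ε : ℝ} (hC : 0 ≤ C) (hε : 0 ≤ ε)
    (h : ∀ n : ℕ, n ≠ 0 → (n.divisors.card : ℝ) ≤ C * (n : ℝ) ^ ε) :
    ((nondegenerateTriples t N).card : ℝ) ≤ (2 * N + 1) * (2 * (C * ((N : ℝ) ^ 2) ^ ε)) := by
  set A := (Finset.Icc (-N : ℤ) N).filter fun a => (a * (t - a) - 1).natAbs ≤ N ^ 2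
  have hA : (A.card : ℝ) ≤ 2 * N + 1 := by
    exact_mod_cast (Finset.card_filter_le _ _).trans (card_Icc_neg_self N).le
  have hfiber : ∀ a ∈ A, ((signedDivisors (a * (t - a) - 1)).card : ℝ)
      ≤ 2 * (C * ((N : ℝ) ^ 2) ^ ε) := by
    intro a ha
    have hle : ((a * (t - a) - 1).natAbs : ℝ) ≤ (N : ℝ) ^ 2 := by
      exact_mod_cast (Finset.mem_filter.mp ha).2
    have hcard : ((signedDivisors (a * (t - a) - 1)).card : ℝ)
        ≤ 2 * (a * (t - a) - 1).natAbs.divisors.card := by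
      exact_mod_cast card_signedDivisors_le (a * (t - a) - 1)
    refine hcard.trans (mul_le_mul_of_nonneg_left ?_ zero_le_two)
    by_cases h0 : (a * (t - a) - 1).natAbs = 0
    · rw [h0, Nat.divisors_zero, Finset.card_empty, Nat.cast_zero]
      positivity
    · exact (h _ h0).trans (by gcongr)
  calc ((nondegenerateTriples t N).card : ℝ)
      ≤ ∑ a ∈ A, ((signedDivisors (a * (t - a) - 1)).card : ℝ) := by
        exact_mod_cast Finset.card_biUnion_le.trans
          (Finset.sum_le_sum fun _ _ => Finset.card_image_le)
    _ ≤ A.card * (2 * (C * ((N : ℝ) ^ 2) ^ ε)) := by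
        simpa using Finset.sum_le_card_nsmul A _ _ hfiber
    _ ≤ _ := by gcongr

theorem mem_triples {a b c d t : ℤ} {N : ℕ} (hdet : a * d - b * c = 1) (htr : a + d = t)
    (ha : |a| ≤ N) (hb : |b| ≤ N) (hc : |c| ≤ N) :
    (a, b, c) ∈ degenerateTriples N ∪ nondegenerateTriples t N := by
  have hbc : a * (t - a) - 1 = b * c := by subst htr; linarith
  rw [Finset.mem_union]
  by_cases h0 : b * c = 0
  · left
    have ha1 : a = 1 ∨ a = -1 :=
      Int.isUnit_iff.mp (IsUnit.of_mul_eq_one d (by linarith))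
    rw [abs_le] at hb hc
    simp only [degenerateTriples, Finset.mem_product, Finset.mem_union, Finset.mem_insert,
      Finset.mem_singleton, Finset.mem_Icc]
    exact ⟨ha1, (mul_eq_zero.mp h0).imp (fun h => ⟨h, hc⟩) fun h => ⟨hb, h⟩⟩
  · right
    simp only [nondegenerateTriples, Finset.mem_biUnion, Finset.mem_filter, Finset.mem_Icc,
      Finset.mem_image]
    refine ⟨a, ⟨abs_le.mp ha, ?_⟩, b, ?_, ?_⟩
    · zify
      rw [hbc, abs_mul, sq]
      exact mul_le_mul hb hc (abs_nonneg c) (Nat.cast_nonneg N)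
    · rw [hbc]
      exact mem_signedDivisors h0 (dvd_mul_right b c)
    · rw [hbc, Int.mul_ediv_cancel_left c (left_ne_zero_of_mul h0)]

theorem abs_apply_le_floor {γ : SL2Z} {T : ℝ} (h : frobNorm γ ≤ T) (i j : Fin 2) :
    |γ i j| ≤ (⌊T⌋₊ : ℤ) := by
  have hT : 0 ≤ T := (Real.sqrt_nonneg _).trans h
  rw [Int.natCast_floor_eq_floor hT, Int.le_floor]
  refine le_trans ?_ h
  rw [Int.cast_abs]
  refine Real.abs_le_sqrt ?_
  norm_cast
  have h00 := sq_nonneg (γ 0 0)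
  have h01 := sq_nonneg (γ 0 1)
  have h10 := sq_nonneg (γ 1 0)
  have h11 := sq_nonneg (γ 1 1)
  fin_cases i <;> fin_cases j <;> simp only [Fin.zero_eta, Fin.mk_one] <;> linarith

theorem card_frobNorm_le_trZ_eq_le (t : ℤ) (T : ℝ) :
    Nat.card {γ : SL2Z // frobNorm γ ≤ T ∧ trZ γ = t} ≤
      (degenerateTriples ⌊T⌋₊).card + (nondegenerateTriples t ⌊T⌋₊).card := by
  let f : {γ : SL2Z // frobNorm γ ≤ T ∧ trZ γ = t} →
      (degenerateTriples ⌊T⌋₊ ∪ nondegenerateTriples t ⌊T⌋₊ : Finset (ℤ × ℤ × ℤ)) :=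
    fun γ => ⟨(γ.1 0 0, γ.1 0 1, γ.1 1 0), mem_triples
      (by rw [← Matrix.det_fin_two, γ.1.det_coe]) γ.2.2 (abs_apply_le_floor γ.2.1 0 0)
      (abs_apply_le_floor γ.2.1 0 1) (abs_apply_le_floor γ.2.1 1 0)⟩
  have hf : Function.Injective f := by
    rintro ⟨γ, _, hγ⟩ ⟨δ, _, hδ⟩ h
    simp only [f, Subtype.mk.injEq, Prod.mk.injEq] at h
    obtain ⟨h00, h01, h10⟩ := h
    have h11 : γ 1 1 = δ 1 1 := by
      unfold trZ at hγ hδ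
      linarith
    refine Subtype.ext (Matrix.SpecialLinearGroup.ext _ _ fun i j => ?_)
    fin_cases i <;> fin_cases j <;> assumption
  refine (Nat.card_le_card_of_injective f hf).trans ?_
  rw [Nat.card_eq_fintype_card, Fintype.card_coe]
  exact Finset.card_union_le _ _

/-- For every `η > 0` there is `C_η > 0` such that for every integer `t` and every real
`T ≥ 2`, the number of `γ ∈ SL(2,ℤ)` with `‖γ‖ ≤ T` and `Tr(γ) = t` is at most
`C_η · T^(1+η)`. -/
theorem statement2 (η : ℝ) (hη : 0 < η) :
    ∃ C : ℝ, 0 < C ∧ ∀ (t : ℤ) (T : ℝ), 2 ≤ T →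
      (Nat.card {γ : SL2Z // frobNorm γ ≤ T ∧ trZ γ = t} : ℝ) ≤ C * T ^ (1 + η) := by
  obtain ⟨C, hC, hdiv⟩ := exists_card_divisors_le_rpow (half_pos hη)
  refine ⟨12 + 6 * C, by positivity, fun t T hT => ?_⟩
  have hT0 : 0 < T := by linarith
  have hN : (⌊T⌋₊ : ℝ) ≤ T := Nat.floor_le hT0.le
  have hcard : (Nat.card {γ : SL2Z // frobNorm γ ≤ T ∧ trZ γ = t} : ℝ) ≤
      (degenerateTriples ⌊T⌋₊).card + (nondegenerateTriples t ⌊T⌋₊).card := by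
    exact_mod_cast card_frobNorm_le_trZ_eq_le t T
  have hdeg : ((degenerateTriples ⌊T⌋₊).card : ℝ) ≤ 4 * (2 * ⌊T⌋₊ + 1) := by
    exact_mod_cast card_degenerateTriples_le ⌊T⌋₊
  have hnondeg := card_nondegenerateTriples_le t (N := ⌊T⌋₊) hC.le (half_pos hη).le hdiv
  have hpow : (T ^ 2) ^ (η / 2) = T ^ η := by
    rw [← Real.rpow_natCast, ← Real.rpow_mul hT0.le]
    congr 1
    push_cast
    ring
  have hone : 1 ≤ T ^ η := Real.one_le_rpow (by linarith) hη.le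
  calc (Nat.card {γ : SL2Z // frobNorm γ ≤ T ∧ trZ γ = t} : ℝ)
      ≤ 4 * (2 * ⌊T⌋₊ + 1) + (2 * ⌊T⌋₊ + 1) * (2 * (C * ((⌊T⌋₊ : ℝ) ^ 2) ^ (η / 2))) :=
        hcard.trans (add_le_add hdeg hnondeg)
    _ ≤ 4 * (2 * T + 1) + (2 * T + 1) * (2 * (C * (T ^ 2) ^ (η / 2))) := by gcongr
    _ ≤ 4 * (3 * T) * T ^ η + (3 * T) * (2 * (C * T ^ η)) := by
        rw [hpow]
        have h3 : 2 * T + 1 ≤ 3 * T := by linarith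
        refine add_le_add ?_ (by gcongr)
        calc 4 * (2 * T + 1) ≤ 4 * (3 * T) := by gcongr
          _ ≤ _ := le_mul_of_one_le_right (by positivity) hone
    _ = (12 + 6 * C) * T ^ (1 + η) := by
        rw [Real.rpow_add hT0, Real.rpow_one]
        ring
end
end

section
/- Let P_k(X) = 2·T_k(X/2), where T_k is the k-th Chebyshev polynomial of the first kind. Then for every integer k ≥ 2 and every real x > 2, P_k(x) ≥ (x−1)^k. Moreover, if k is odd and |x| > 2, then P_k(x) has the same sign as x. -/
noncomputable section

open Polynomial

namespace Polynomial.Chebyshev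

theorem eval_T_add_two {R : Type*} [CommRing R] (n : ℕ) (y : R) :
    (T R (n + 2 : ℕ)).eval y = 2 * y * (T R (n + 1 : ℕ)).eval y - (T R n).eval y := by
  push_cast
  simp [T_add_two]

theorem one_le_eval_T_and_eval_T_le_eval_T_succ {y : ℝ} (hy : 1 ≤ y) (n : ℕ) :
    1 ≤ (T ℝ n).eval y ∧ (T ℝ n).eval y ≤ (T ℝ (n + 1 : ℕ)).eval y := by
  induction n with
  | zero => simpa using hy
  | succ n ih =>
    have h := eval_T_add_two n y
    exact ⟨ih.1.trans ih.2, by nlinarith⟩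

theorem two_mul_sub_one_pow_le_two_mul_eval_T {y : ℝ} (hy : 1 ≤ y) (n : ℕ) :
    (2 * y - 1) ^ n ≤ 2 * (T ℝ n).eval y := by
  rcases n with _ | n
  · simp
  induction n with
  | zero => simp
  | succ n ih =>
    have h := eval_T_add_two n y
    have hmono := (one_le_eval_T_and_eval_T_le_eval_T_succ hy n).2
    calc (2 * y - 1) ^ (n + 1 + 1) = (2 * y - 1) ^ (n + 1) * (2 * y - 1) := pow_succ _ _
      _ ≤ 2 * (T ℝ (n + 1 : ℕ)).eval y * (2 * y - 1) := by gcongr; linarith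
      _ ≤ 2 * (T ℝ (n + 2 : ℕ)).eval y := by linarith

end Polynomial.Chebyshev

/-- Let `P_k(X) = 2·T_k(X/2)` with `T_k` the `k`-th Chebyshev polynomial of the first
kind. For every `k ≥ 2` and real `x > 2`, `P_k(x) ≥ (x-1)^k`; moreover if `k` is odd and
`|x| > 2` then `P_k(x)` has the same sign as `x`. -/
theorem statement4 (k : ℕ) (hk : 2 ≤ k) :
    (∀ x : ℝ, 2 < x → (x - 1) ^ k ≤ 2 * (Polynomial.Chebyshev.T ℝ k).eval (x / 2)) ∧
    (Odd k → ∀ x : ℝ, 2 < |x| →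
      0 < x * (2 * (Polynomial.Chebyshev.T ℝ k).eval (x / 2))) := by
  have hpos : ∀ y : ℝ, 1 ≤ y → 0 < (Chebyshev.T ℝ k).eval y := fun y hy =>
    zero_lt_one.trans_le (Chebyshev.one_le_eval_T_and_eval_T_le_eval_T_succ hy k).1
  refine ⟨fun x hx => ?_, fun hodd x hx => ?_⟩
  · have h := Chebyshev.two_mul_sub_one_pow_le_two_mul_eval_T (y := x / 2) (by linarith) k
    rwa [mul_div_cancel₀ x two_ne_zero] at h
  · rcases lt_abs.mp hx with h | h
    · have := hpos (x / 2) (by linarith)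
      have : 0 < x := by linarith
      positivity
    · have hT := hpos (-(x / 2)) (by linarith)
      rw [Chebyshev.T_eval_neg, Int.negOnePow_odd _ (by exact_mod_cast hodd)] at hT
      push_cast at hT
      nlinarith
end
end
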